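/- arXiv:1212.6280 — 2 statements merged into one kernel-verified Lean document; each statement's English description precedes it below -/
import Mathlib

section
/- (Chaoticity of the steady state marginals) Let F_N(V) = (1/Z̃_N)(Σ_{i=1}^N |v_i|^{2+α})^{−(dN−1)/(2+α)} be the normalized density on the sphere S^{dN−1}(√N), and let f^{(k)}_N be its k-particle marginal. Then for every bounded continuous φ : ℝ^{dk} → ℝ, lim_{N→∞} ∫ φ(v_1,…,v_k) f^{(k)}_N dv_1⋯dv_k = ∫ φ(v_1,…,v_k) ∏_{i=1}^k f(v_i) dv_1⋯dv_k, where f(v) = (μ^{d/2}/c) e^{−(√μ |v|)^{2+α}}, c = ∫_{ℝ^d} e^{−|v|^{2+α}} dv, μ = Γ((d+2)/(2+α))/Γ(d/(2+α)). -/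
open Real MeasureTheory Filter

/-- Polar coordinates for the lower Lebesgue integral. -/
lemma lintegral_eq_lintegral_sphere_lintegral_Ioi {E : Type*} [NormedAddCommGroup E]
    [NormedSpace ℝ E] [MeasurableSpace E] [BorelSpace E] [FiniteDimensional ℝ E] [Nontrivial E]
    (ν : Measure E) [ν.IsAddHaarMeasure] {F : E → ENNReal} (hF : Measurable F) :
    ∫⁻ x, F x ∂ν = ∫⁻ ω, (∫⁻ r in Set.Ioi (0 : ℝ),
      ENNReal.ofReal (r ^ (Module.finrank ℝ E - 1)) * F (r • (ω : E))) ∂ν.toSphere := by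
  have h1 : ∫⁻ x, F x ∂ν = ∫⁻ x : ({(0)}ᶜ : Set E), F x ∂(ν.comap (↑)) := by
    rw [lintegral_subtype_comap (measurableSet_singleton _).compl F,
      restrict_compl_singleton]
  have h2 := ν.measurePreserving_homeomorphUnitSphereProd.lintegral_comp_emb
    (Homeomorph.measurableEmbedding _) (fun z => F ((z.2 : ℝ) • (z.1 : E)))
  have h3 : ∀ x : ({(0)}ᶜ : Set E), ((homeomorphUnitSphereProd E x).2 : ℝ) •
      ((homeomorphUnitSphereProd E x).1 : E) = x := fun x => by
    rw [← homeomorphUnitSphereProd_symm_apply_coe, Homeomorph.symm_apply_apply]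
  simp only [h3] at h2
  have hm : Measurable fun z : Metric.sphere (0 : E) 1 × Set.Ioi (0 : ℝ) =>
      F ((z.2 : ℝ) • (z.1 : E)) := hF.comp (by fun_prop)
  rw [h1, h2, lintegral_prod _ hm.aemeasurable]
  refine lintegral_congr fun ω => ?_
  rw [Measure.volumeIoiPow, lintegral_withDensity_eq_lintegral_mul
    (g := fun r : Set.Ioi (0 : ℝ) => F ((r : ℝ) • (ω : E))) _ (by fun_prop)
    (hF.comp (by fun_prop))]
  exact lintegral_subtype_comap measurableSet_Ioi
    (fun r : ℝ => ENNReal.ofReal (r ^ (Module.finrank ℝ E - 1)) * F (r • (ω : E)))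

lemma lintegral_Ioi_rpow_mul_exp_neg_mul_rpow {p q s : ℝ} (hp : 0 < p) (hq : 0 < q)
    (hs : 0 < s) :
    ∫⁻ R in Set.Ioi (0 : ℝ), ENNReal.ofReal (R ^ (q - 1) * exp (-s * R ^ p)) =
      ENNReal.ofReal (s ^ (-q / p) * ((1 / p) * Gamma (q / p))) := by
  rw [← ofReal_integral_eq_lintegral_ofReal
    (integrableOn_rpow_mul_exp_neg_mul_rpow (by linarith) hp hs)
    ((ae_restrict_mem measurableSet_Ioi).mono fun R (hR : 0 < R) => by
      simp only [Pi.zero_apply]; positivity),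
    integral_rpow_mul_exp_neg_mul_rpow hp (by linarith) hs, sub_add_cancel, mul_assoc]

lemma lintegral_comp_smul_eq {V : Type*} [NormedAddCommGroup V]
    [NormedSpace ℝ V] [MeasurableSpace V] [BorelSpace V] [FiniteDimensional ℝ V]
    (ν : Measure V) [ν.IsAddHaarMeasure] (H : V → ENNReal) {R : ℝ} (hR : 0 < R) :
    ∫⁻ x, H (R • x) ∂ν = ENNReal.ofReal ((R ^ Module.finrank ℝ V)⁻¹) * ∫⁻ x, H x ∂ν := by
  have he : MeasurableEmbedding (fun x : V => R • x) :=
    (Homeomorph.smulOfNeZero R hR.ne').measurableEmbedding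
  rw [← he.lintegral_map, Measure.map_addHaar_smul ν hR.ne', lintegral_smul_measure,
    abs_of_pos (by positivity), smul_eq_mul]

lemma lintegral_Ioi_sqrt_div {a N : ℝ} (ha : 0 ≤ a) (hN : 0 < N) (G : ℝ → ENNReal) :
    ∫⁻ R in Set.Ioi (√(a / N)), G R =
      ∫⁻ r in Set.Ioi (0 : ℝ), ENNReal.ofReal (r / (√N * √(a + r ^ 2))) * G (√((a + r ^ 2) / N)) := by
  have him : (fun r : ℝ => √((a + r ^ 2) / N)) '' Set.Ioi 0 = Set.Ioi (√(a / N)) := by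
    ext R
    simp only [Set.mem_image, Set.mem_Ioi]
    constructor
    · rintro ⟨r, hr, rfl⟩
      apply Real.sqrt_lt_sqrt (by positivity)
      gcongr
      nlinarith [sq_pos_of_pos hr]
    · intro hR
      have hR0 : 0 < R := lt_of_le_of_lt (sqrt_nonneg _) hR
      have h1 : a / N < R ^ 2 := (Real.sqrt_lt' hR0).1 hR
      have h2 : 0 < N * R ^ 2 - a := by
        rw [div_lt_iff₀ hN] at h1; linarith
      refine ⟨√(N * R ^ 2 - a), Real.sqrt_pos.2 h2, ?_⟩
      rw [Real.sq_sqrt h2.le, add_sub_cancel, mul_div_cancel_left₀ _ hN.ne', Real.sqrt_sq hR0.le]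
  rw [← him, lintegral_image_eq_lintegral_abs_deriv_mul measurableSet_Ioi
    (f' := fun r => r / (√N * √(a + r ^ 2)))]
  · refine setLIntegral_congr_fun measurableSet_Ioi fun r (hr : 0 < r) => ?_
    rw [abs_of_nonneg (by positivity)]
  · intro r (hr : 0 < r)
    have hpos : 0 < a + r ^ 2 := by positivity
    have h1 : HasDerivAt (fun r : ℝ => (a + r ^ 2) / N) (2 * r / N) r := by
      simpa using ((hasDerivAt_pow 2 r).const_add a).div_const N
    have h2 := h1.sqrt (by positivity)
    refine (h2.congr_deriv ?_).hasDerivWithinAt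
    rw [Real.sqrt_div hpos.le]
    have h3 : √N ^ 2 = N := Real.sq_sqrt hN.le
    have : 0 < √N := Real.sqrt_pos.2 hN
    have : 0 < √(a + r ^ 2) := Real.sqrt_pos.2 hpos
    field_simp
    rw [h3]
  · intro r (hr : 0 < r) r' (hr' : 0 < r') h
    simp only at h
    rw [Real.sqrt_inj (by positivity) (by positivity)] at h
    have : r ^ 2 = r' ^ 2 := by
      field_simp at h
      linarith
    exact (pow_left_inj₀ hr.le hr'.le two_ne_zero).1 this

/-- Slicing identity: the density on the ball `{q < N}` obtained by integrating out the radial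
variable of a `p`-homogeneous exponential weight is, up to the Gamma factor, the image of that
weight under radial projection. -/
lemma lintegral_slice {V : Type*} [NormedAddCommGroup V]
    [NormedSpace ℝ V] [MeasurableSpace V] [BorelSpace V] [FiniteDimensional ℝ V]
    (ν : Measure V) [ν.IsAddHaarMeasure] {p A N n : ℝ} {D : ℕ} (hp : 0 < p) (hA : 0 < A)
    (hN : 0 < N) (hD : 1 ≤ D) (hn : n = Module.finrank ℝ V + D) (hn1 : 1 < n)
    {q B : V → ℝ} (hq : Measurable q) (hB : Measurable B) (hq0 : ∀ x, 0 ≤ q x)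
    (hB0 : ∀ x, 0 ≤ B x) (hqs : ∀ R, 0 < R → ∀ x, q (R • x) = R ^ 2 * q x)
    (hBs : ∀ R, 0 < R → ∀ x, B (R • x) = R ^ p * B x) {g : V → ENNReal} (hg : Measurable g) :
    (∫⁻ u in {u | q u < N}, g u * ENNReal.ofReal (√(N / (N - q u)) * (√(N - q u) ^ (D - 1) *
        (B u + √(N - q u) ^ p * A) ^ (-(n - 1) / p))) ∂ν) *
      ENNReal.ofReal ((1 / p) * Gamma ((n - 1) / p)) =
    ∫⁻ x, (∫⁻ r in Set.Ioi (0 : ℝ), ENNReal.ofReal (r ^ (D - 1)) *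
      (g ((√N / √(q x + r ^ 2)) • x) *
        ENNReal.ofReal ((√(q x + r ^ 2))⁻¹ * exp (-(B x + r ^ p * A))))) ∂ν := by
  have hms : MeasurableSet {u | q u < N} := measurableSet_lt hq measurable_const
  have hG : 0 < (1 / p) * Gamma ((n - 1) / p) := by
    have := Gamma_pos_of_pos (show 0 < (n - 1) / p from div_pos (by linarith) hp)
    positivity
  set w : V → ℝ := fun u => √(N / (N - q u)) * √(N - q u) ^ (D - 1) with hw
  set S : V → ℝ := fun u => B u + √(N - q u) ^ p * A with hS
  have hwm : Measurable w := by fun_prop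
  have hSm : Measurable S := by fun_prop
  have hradius : (∫⁻ u in {u | q u < N}, g u * ENNReal.ofReal (√(N / (N - q u)) *
        (√(N - q u) ^ (D - 1) *
        (B u + √(N - q u) ^ p * A) ^ (-(n - 1) / p))) ∂ν) *
      ENNReal.ofReal ((1 / p) * Gamma ((n - 1) / p)) =
      ∫⁻ u in {u | q u < N}, (∫⁻ R in Set.Ioi (0 : ℝ),
        g u * ENNReal.ofReal (w u * (R ^ (n - 1 - 1) * exp (-S u * R ^ p)))) ∂ν := by
    rw [← lintegral_mul_const _ (by fun_prop)]
    refine setLIntegral_congr_fun hms fun u (hu : q u < N) => ?_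
    have hτ : 0 < √(N - q u) := Real.sqrt_pos.2 (by linarith)
    have hSu : 0 < S u := by
      have := hB0 u
      simp only [hS]; positivity
    have hwu : 0 ≤ w u := by simp only [hw]; positivity
    simp_rw [ENNReal.ofReal_mul hwu, ← mul_assoc]
    rw [lintegral_const_mul _ (by fun_prop), lintegral_Ioi_rpow_mul_exp_neg_mul_rpow hp
      (by linarith) hSu, mul_assoc, mul_assoc (g u), ← ENNReal.ofReal_mul hwu,
      ← ENNReal.ofReal_mul (by positivity)]
    congr 2
    simp only [hw, hS]
    ring
  have hmeas : Measurable (fun z : V × ℝ =>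
      g z.1 * ENNReal.ofReal (w z.1 * (z.2 ^ (n - 1 - 1) * exp (-S z.1 * z.2 ^ p)))) :=
    (hg.comp measurable_fst).mul (by fun_prop)
  have hint2 : ∀ R : ℝ, 0 < R → ∫⁻ u in {u | q u < N},
        g u * ENNReal.ofReal (w u * (R ^ (n - 1 - 1) * exp (-S u * R ^ p))) ∂ν =
      ∫⁻ x, (Set.Ioi √(q x / N)).indicator (fun R => g (R⁻¹ • x) * ENNReal.ofReal (√N * R ^ (D - 1) *
        √(N - q (R⁻¹ • x)) ^ (D - 1) / (R * √(N - q (R⁻¹ • x))) * exp (-S (R⁻¹ • x) * R ^ p))) R ∂ν := by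
    intro R hR
    rw [← lintegral_indicator hms]
    have := lintegral_comp_smul_eq ν ({u | q u < N}.indicator fun u =>
      g u * ENNReal.ofReal (w u * (R ^ (n - 1 - 1) * exp (-S u * R ^ p)))) (R := R⁻¹) (by positivity)
    have h2 : ENNReal.ofReal ((R ^ Module.finrank ℝ V)⁻¹) *
        ENNReal.ofReal ((R⁻¹ ^ Module.finrank ℝ V)⁻¹) = 1 := by
      rw [← ENNReal.ofReal_mul (by positivity), inv_pow, inv_inv, inv_mul_cancel₀ (by positivity),
        ENNReal.ofReal_one]
    rw [← one_mul (∫⁻ _, _ ∂ν), ← h2, mul_assoc, ← this, ← lintegral_const_mul']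
    · refine lintegral_congr fun x => ?_
      have hiff : q (R⁻¹ • x) < N ↔ √(q x / N) < R := by
        rw [Real.sqrt_lt' hR, hqs _ (by positivity), div_lt_iff₀ hN, inv_pow, inv_mul_lt_iff₀ (by positivity)]
      by_cases hx : q (R⁻¹ • x) < N
      · rw [Set.indicator_of_mem (by exact hx), Set.indicator_of_mem (by exact hiff.1 hx),
          mul_left_comm, ← ENNReal.ofReal_mul (by positivity)]
        congr 2
        have hτ : 0 < √(N - q (R⁻¹ • x)) := Real.sqrt_pos.2 (by linarith)
        have e1 : R ^ (n - 1 - 1) = R ^ Module.finrank ℝ V * R ^ (D - 1) / R := by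
          rw [show n - 1 - 1 = (Module.finrank ℝ V : ℝ) + ((D - 1 : ℕ) : ℝ) - 1 by
            rw [hn]; push_cast [hD]; ring, Real.rpow_sub_one hR.ne', Real.rpow_add hR,
            Real.rpow_natCast, Real.rpow_natCast]
        rw [e1]
        simp only [hw]
        rw [Real.sqrt_div hN.le]
        field_simp
      · rw [Set.indicator_of_notMem (by exact hx), Set.indicator_of_notMem (by
          intro h; exact hx (hiff.2 h)), mul_zero]
    · exact ENNReal.ofReal_ne_top
  rw [hradius, lintegral_lintegral_swap (f := fun u R => g u * ENNReal.ofReal (w u * (R ^ (n - 1 - 1) * exp (-S u * R ^ p)))) hmeas.aemeasurable,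
    setLIntegral_congr_fun measurableSet_Ioi hint2, lintegral_lintegral_swap]
  · refine lintegral_congr fun x => ?_
    rw [lintegral_indicator measurableSet_Ioi, Measure.restrict_restrict measurableSet_Ioi,
      Set.inter_eq_left.2 (Set.Ioi_subset_Ioi (sqrt_nonneg _)),
      lintegral_Ioi_sqrt_div (hq0 x) hN]
    refine setLIntegral_congr_fun measurableSet_Ioi fun r (hr : 0 < r) => ?_
    have hq0 := hq0 x
    have hpos : 0 < q x + r ^ 2 := by positivity
    have hs : 0 < √(q x + r ^ 2) := Real.sqrt_pos.2 hpos
    have hsN : 0 < √N := Real.sqrt_pos.2 hN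
    set R := √((q x + r ^ 2) / N) with hR
    have hRdef : R = √(q x + r ^ 2) / √N := Real.sqrt_div hpos.le _
    have hR0 : 0 < R := by positivity
    have hinv : R⁻¹ = √N / √(q x + r ^ 2) := by rw [hRdef, inv_div]
    have hτ : √(N - q (R⁻¹ • x)) = r / R := by
      rw [hqs _ (by positivity)]
      have : N - R⁻¹ ^ 2 * q x = (r / R) ^ 2 := by
        have h3 : √N ^ 2 = N := Real.sq_sqrt hN.le
        have h4 : √(q x + r ^ 2) ^ 2 = q x + r ^ 2 := Real.sq_sqrt hpos.le
        rw [div_eq_mul_inv, mul_pow, hinv, div_pow, h3, h4]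
        field_simp
        ring
      rw [this, Real.sqrt_sq (by positivity)]
    have hSR : -S (R⁻¹ • x) * R ^ p = -(B x + r ^ p * A) := by
      simp only [hS]
      rw [hτ, hBs _ (by positivity), Real.inv_rpow hR0.le, Real.div_rpow hr.le hR0.le]
      have : 0 < R ^ p := by positivity
      field_simp
    rw [hτ, hSR, ← hinv, mul_left_comm, mul_left_comm (ENNReal.ofReal (r ^ (D - 1))),
      ← ENNReal.ofReal_mul (by positivity), ← ENNReal.ofReal_mul (by positivity)]
    congr 2
    rw [div_pow]
    field_simp
  · have : (Function.uncurry fun (R : ℝ) (x : V) => (Set.Ioi √(q x / N)).indicator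
        (fun R => g (R⁻¹ • x) * ENNReal.ofReal (√N * R ^ (D - 1) *
        √(N - q (R⁻¹ • x)) ^ (D - 1) / (R * √(N - q (R⁻¹ • x))) * exp (-S (R⁻¹ • x) * R ^ p))) R) =
      {z : ℝ × V | √(q z.2 / N) < z.1}.indicator (fun z => g (z.1⁻¹ • z.2) *
        ENNReal.ofReal (√N * z.1 ^ (D - 1) *
        √(N - q (z.1⁻¹ • z.2)) ^ (D - 1) / (z.1 * √(N - q (z.1⁻¹ • z.2))) * exp (-S (z.1⁻¹ • z.2) * z.1 ^ p))) := by
      ext z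
      by_cases hz : √(q z.2 / N) < z.1 <;> simp [Function.uncurry, Set.indicator, hz]
    rw [this]
    refine (Measurable.indicator ?_ (measurableSet_lt (by fun_prop) measurable_fst)).aemeasurable
    have hsm : Measurable fun z : ℝ × V => z.1⁻¹ • z.2 := by fun_prop
    have h1 : Measurable fun z : ℝ × V => q (z.1⁻¹ • z.2) := hq.comp hsm
    have h2 : Measurable fun z : ℝ × V => S (z.1⁻¹ • z.2) := hSm.comp hsm
    exact (hg.comp hsm).mul (by fun_prop)

/-- The marginal on the ball `{q < N}` of a homogeneous density on a sphere, expressed through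
the corresponding exponential weight on the full space. -/
lemma lintegral_sphere_marginal {V W : Type*} [NormedAddCommGroup V]
    [NormedSpace ℝ V] [MeasurableSpace V] [BorelSpace V] [FiniteDimensional ℝ V]
    (ν : Measure V) [ν.IsAddHaarMeasure] [NormedAddCommGroup W]
    [NormedSpace ℝ W] [MeasurableSpace W] [BorelSpace W] [FiniteDimensional ℝ W] [Nontrivial W]
    (η : Measure W) [η.IsAddHaarMeasure] {p N n : ℝ} (hp : 0 < p) (hN : 0 < N)
    (hn : n = Module.finrank ℝ V + Module.finrank ℝ W) (hn1 : 1 < n)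
    {q B : V → ℝ} (hq : Measurable q) (hB : Measurable B) (hq0 : ∀ x, 0 ≤ q x)
    (hB0 : ∀ x, 0 ≤ B x) (hqs : ∀ R, 0 < R → ∀ x, q (R • x) = R ^ 2 * q x)
    (hBs : ∀ R, 0 < R → ∀ x, B (R • x) = R ^ p * B x) {A : W → ℝ} (hA : Continuous A)
    (hA0 : ∀ y, y ≠ 0 → 0 < A y) (hAs : ∀ R, 0 < R → ∀ y, A (R • y) = R ^ p * A y)
    {g : V → ENNReal} (hg : Measurable g) :
    (∫⁻ u in {u | q u < N}, g u * ENNReal.ofReal (√(N / (N - q u)) *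
        (√(N - q u) ^ (Module.finrank ℝ W - 1) *
        ∫ ω, (B u + √(N - q u) ^ p * A (ω : Metric.sphere (0 : W) 1)) ^ (-(n - 1) / p)
          ∂η.toSphere)) ∂ν) *
      ENNReal.ofReal ((1 / p) * Gamma ((n - 1) / p)) =
    ∫⁻ x, (∫⁻ y, g ((√N / √(q x + ‖y‖ ^ 2)) • x) *
        ENNReal.ofReal ((√(q x + ‖y‖ ^ 2))⁻¹ * exp (-(B x + A y))) ∂η) ∂ν := by
  have hms : MeasurableSet {u | q u < N} := measurableSet_lt hq measurable_const
  have hAm : Measurable A := hA.measurable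
  have hAω : ∀ ω : Metric.sphere (0 : W) 1, 0 < A ω := fun ω =>
    hA0 _ (by intro h; simpa [h] using ω.2)
  set D := Module.finrank ℝ W with hDdef
  have hD : 1 ≤ D := Module.finrank_pos
  set F : V → Metric.sphere (0 : W) 1 → ENNReal := fun u ω => g u * ENNReal.ofReal
    (√(N / (N - q u)) * (√(N - q u) ^ (D - 1) * (B u + √(N - q u) ^ p * A ω) ^ (-(n - 1) / p)))
    with hF
  have hFm : Measurable (Function.uncurry F) := by
    have hB' : Measurable fun z : V × Metric.sphere (0 : W) 1 => B z.1 := hB.comp measurable_fst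
    have hq' : Measurable fun z : V × Metric.sphere (0 : W) 1 => q z.1 := hq.comp measurable_fst
    have hA' : Measurable fun z : V × Metric.sphere (0 : W) 1 => A z.2 := hAm.comp (by fun_prop)
    have hg' : Measurable fun z : V × Metric.sphere (0 : W) 1 => g z.1 := hg.comp measurable_fst
    unfold Function.uncurry
    simp only [hF]
    exact hg'.mul (by fun_prop)
  have hradius : ∫⁻ u in {u | q u < N}, g u * ENNReal.ofReal (√(N / (N - q u)) *
        (√(N - q u) ^ (D - 1) *
        ∫ ω, (B u + √(N - q u) ^ p * A (ω : Metric.sphere (0 : W) 1)) ^ (-(n - 1) / p)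
          ∂η.toSphere)) ∂ν = ∫⁻ u in {u | q u < N}, (∫⁻ ω, F u ω ∂η.toSphere) ∂ν := by
    refine setLIntegral_congr_fun hms fun u (hu : q u < N) => ?_
    have hτ : 0 < √(N - q u) := Real.sqrt_pos.2 (by linarith)
    have hpos : ∀ ω : Metric.sphere (0 : W) 1, 0 < B u + √(N - q u) ^ p * A ω := fun ω => by
      have := hB0 u
      have := hAω ω
      positivity
    have hc : Continuous fun ω : Metric.sphere (0 : W) 1 =>
        (B u + √(N - q u) ^ p * A ω) ^ (-(n - 1) / p) :=
      Continuous.rpow_const (by fun_prop) fun ω => Or.inl (hpos ω).ne'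
    simp only [hF]
    rw [lintegral_const_mul _ (by fun_prop)]
    simp_rw [← mul_assoc (√(N / (N - q u)))]
    rw [← integral_const_mul, ofReal_integral_eq_lintegral_ofReal]
    · exact (hc.integrable_of_hasCompactSupport (HasCompactSupport.of_compactSpace _)).const_mul _
    · exact Eventually.of_forall fun ω => by
        have := hpos ω
        simp only [Pi.zero_apply]
        positivity
  set G : V → W → ENNReal := fun x y => g ((√N / √(q x + ‖y‖ ^ 2)) • x) *
        ENNReal.ofReal ((√(q x + ‖y‖ ^ 2))⁻¹ * exp (-(B x + A y))) with hG
  have hGm : Measurable (Function.uncurry G) := by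
    have hB' : Measurable fun z : V × W => B z.1 := hB.comp measurable_fst
    have hq' : Measurable fun z : V × W => q z.1 := hq.comp measurable_fst
    have hA' : Measurable fun z : V × W => A z.2 := hAm.comp measurable_snd
    have hg' : Measurable fun z : V × W => g ((√N / √(q z.1 + ‖z.2‖ ^ 2)) • z.1) :=
      hg.comp (by fun_prop)
    unfold Function.uncurry
    simp only [hG]
    exact hg'.mul (by fun_prop)
  rw [hradius, lintegral_lintegral_swap hFm.aemeasurable, ← lintegral_mul_const']
  · have hint2 : ∀ ω, (∫⁻ u in {u | q u < N}, F u ω ∂ν) *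
        ENNReal.ofReal ((1 / p) * Gamma ((n - 1) / p)) = ∫⁻ x, (∫⁻ r in Set.Ioi (0 : ℝ),
          ENNReal.ofReal (r ^ (D - 1)) * G x (r • (ω : W))) ∂ν := by
      intro ω
      rw [lintegral_slice ν hp (hAω ω) hN hD hn hn1 hq hB hq0 hB0 hqs hBs hg]
      refine lintegral_congr fun x => setLIntegral_congr_fun measurableSet_Ioi
        fun r (hr : 0 < r) => ?_
      have hω : ‖(ω : W)‖ = 1 := by simp
      simp only [hG]
      rw [norm_smul, hω, mul_one, hAs r hr, Real.norm_of_nonneg hr.le]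
    rw [lintegral_congr hint2, lintegral_lintegral_swap]
    · exact lintegral_congr fun x =>
        (lintegral_eq_lintegral_sphere_lintegral_Ioi η (hGm.comp measurable_prodMk_left)).symm
    · have : Measurable fun z : (Metric.sphere (0 : W) 1 × V) × ℝ =>
          ENNReal.ofReal (z.2 ^ (D - 1)) * Function.uncurry G (z.1.2, z.2 • (z.1.1 : W)) :=
        Measurable.mul (by fun_prop) (hGm.comp (by fun_prop))
      exact (this.lintegral_prod_right' (ν := volume.restrict (Set.Ioi 0))).aemeasurable
  · exact ENNReal.ofReal_ne_top

lemma integrable_norm_rpow_mul_exp_neg {E : Type*} [NormedAddCommGroup E]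
    [NormedSpace ℝ E] [MeasurableSpace E] [BorelSpace E] [FiniteDimensional ℝ E] [Nontrivial E]
    (ν : Measure E) [ν.IsAddHaarMeasure] {p s : ℝ} (hp : 0 < p)
    (hs : 0 < Module.finrank ℝ E + s) :
    Integrable (fun x : E => ‖x‖ ^ s * exp (-‖x‖ ^ p)) ν ∧
    ∫ x, ‖x‖ ^ s * exp (-‖x‖ ^ p) ∂ν = Module.finrank ℝ E * ν.real (Metric.ball 0 1) *
      (1 / p * Gamma ((Module.finrank ℝ E + s) / p)) := by
  have hD : 1 ≤ Module.finrank ℝ E := Module.finrank_pos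
  have h1 : Set.EqOn
      (fun y : ℝ => y ^ (Module.finrank ℝ E - 1) • (y ^ s * exp (-y ^ p)))
      (fun y => y ^ (Module.finrank ℝ E + s - 1) * exp (-1 * y ^ p)) (Set.Ioi 0) := by
    intro y (hy : 0 < y)
    simp only
    rw [show (Module.finrank ℝ E : ℝ) + s - 1 = ((Module.finrank ℝ E - 1 : ℕ) : ℝ) + s by
      push_cast [hD]; ring, Real.rpow_add hy, Real.rpow_natCast, smul_eq_mul, neg_one_mul,
      mul_assoc]
  constructor
  · refine (integrable_fun_norm_addHaar ν (f := fun y => y ^ s * exp (-y ^ p))).2 ?_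
    exact (integrableOn_congr_fun h1 measurableSet_Ioi).2
      (integrableOn_rpow_mul_exp_neg_mul_rpow (by linarith) hp one_pos)
  · rw [integral_fun_norm_addHaar ν (fun y => y ^ s * exp (-y ^ p)),
      setIntegral_congr_fun measurableSet_Ioi h1,
      integral_rpow_mul_exp_neg_mul_rpow hp (by linarith) one_pos, Real.one_rpow, sub_add_cancel,
      nsmul_eq_mul, smul_eq_mul]
    ring

lemma pi_withDensity_ofReal {ι X : Type*} [Fintype ι] [MeasurableSpace X] (ν : Measure X)
    [SigmaFinite ν] {f : X → ℝ} (hf0 : ∀ x, 0 ≤ f x) (hfi : Integrable f ν) :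
    (Measure.pi fun _ : ι => ν.withDensity fun x => ENNReal.ofReal (f x)) =
      (Measure.pi fun _ : ι => ν).withDensity fun x => ENNReal.ofReal (∏ i, f (x i)) := by
  have : IsFiniteMeasure (ν.withDensity fun x => ENNReal.ofReal (f x)) :=
    isFiniteMeasure_withDensity_ofReal hfi.2
  refine (Measure.pi_eq fun s hs => ?_)
  have hi : ∀ i, Integrable ((s i).indicator f) ν := fun i => hfi.indicator (hs i)
  have h0 : ∀ i x, 0 ≤ (s i).indicator f x := fun i x => Set.indicator_nonneg (fun x _ => hf0 x) x
  rw [withDensity_apply _ (MeasurableSet.univ_pi hs), ← lintegral_indicator (MeasurableSet.univ_pi hs)]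
  calc _ = ∫⁻ x : ι → X, ENNReal.ofReal (∏ i, (s i).indicator f (x i)) ∂Measure.pi fun _ => ν := by
        refine lintegral_congr fun x => ?_
        by_cases hx : x ∈ Set.univ.pi s
        · rw [Set.indicator_of_mem hx]
          congr 1
          exact Finset.prod_congr rfl fun i _ => (Set.indicator_of_mem (hx i trivial) f).symm
        · rw [Set.indicator_of_notMem hx]
          simp only [Set.mem_pi, Set.mem_univ, true_imp_iff, not_forall] at hx
          obtain ⟨i, hi⟩ := hx
          rw [Finset.prod_eq_zero (Finset.mem_univ i) (Set.indicator_of_notMem hi f),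
            ENNReal.ofReal_zero]
    _ = ENNReal.ofReal (∏ i, ∫ x, (s i).indicator f x ∂ν) := by
        rw [← integral_fintype_prod_eq_prod (fun i => (s i).indicator f),
          ofReal_integral_eq_lintegral_ofReal (Integrable.fintype_prod hi)]
        exact Eventually.of_forall fun x => Finset.prod_nonneg fun i _ => h0 i _
    _ = _ := by
        rw [ENNReal.ofReal_prod_of_nonneg fun i _ => integral_nonneg (h0 i)]
        refine Finset.prod_congr rfl fun i _ => ?_
        rw [ofReal_integral_eq_lintegral_ofReal (hi i) (Eventually.of_forall (h0 i)),
          withDensity_apply _ (hs i), ← lintegral_indicator (hs i)]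
        refine lintegral_congr fun x => ?_
        by_cases hx : x ∈ s i <;> simp [hx]

/-- The coordinates of an infinite product of copies of `ρ` along an injective family of indices
have the finite product law. -/
lemma map_infinitePi_comp_injective {ι X : Type*} [Fintype ι] [MeasurableSpace X] (ρ : Measure X)
    [IsProbabilityMeasure ρ] {e : ι → ℕ} (he : Function.Injective e) :
    (Measure.infinitePi fun _ : ℕ => ρ).map (fun ω i => ω (e i)) = Measure.pi fun _ : ι => ρ := by
  have h := (ProbabilityTheory.iIndepFun_infinitePi (P := fun _ : ℕ => ρ)
    (X := fun _ x => x) (fun _ => measurable_id)).precomp he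
  rw [ProbabilityTheory.iIndepFun.map_fun_eq_pi_map (fun i => (measurable_pi_apply (e i)).aemeasurable) h]
  congr 1
  ext1 i
  exact Measure.infinitePi_map_eval (fun _ => ρ) (e i)

lemma tendsto_integral_of_ae_tendsto_of_integral_sq_le {Ω : Type*} [MeasurableSpace Ω]
    {P : Measure Ω} [IsProbabilityMeasure P] {Y : ℕ → Ω → ℝ} {Z : Ω → ℝ} {C b : ℝ}
    (hY : ∀ n, Measurable (Y n)) (hZb : ∀ ω, |Z ω| ≤ b)
    (hlim : ∀ᵐ ω ∂P, Tendsto (fun n => Y n ω) atTop (nhds (Z ω)))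
    (hC : ∀ᶠ n in atTop, Integrable (fun ω => Y n ω ^ 2) P ∧ ∫ ω, Y n ω ^ 2 ∂P ≤ C) :
    Tendsto (fun n => ∫ ω, Y n ω ∂P) atTop (nhds (∫ ω, Z ω ∂P)) := by
  rw [Metric.tendsto_atTop']
  have hC0 : 0 ≤ C := by
    obtain ⟨n, -, hn⟩ := hC.exists
    exact le_trans (integral_nonneg fun ω => sq_nonneg _) hn
  have hb0 : 0 ≤ b := by
    have : Nonempty Ω := nonempty_of_isProbabilityMeasure P
    exact le_trans (abs_nonneg _) (hZb (Classical.arbitrary Ω))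
  intro ε hε
  set M : ℝ := b + 2 * C / ε + 1 with hM
  have hMpos : 0 < M := by positivity
  have hbM : b ≤ M := by
    have : 0 ≤ 2 * C / ε := by positivity
    linarith
  set T : ℝ → ℝ := fun y => max (-M) (min M y) with hT
  have hTc : Continuous T := by fun_prop
  have hTb : ∀ y, |T y| ≤ M := fun y => abs_le.2
    ⟨le_max_left _ _, max_le (by linarith) (min_le_left _ _)⟩
  have hTZ : ∀ ω, T (Z ω) = Z ω := fun ω => by
    have := abs_le.1 (hZb ω)
    simp only [hT]
    rw [min_eq_right (by linarith), max_eq_right (by linarith)]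
  have hTd : ∀ y, |y - T y| ≤ y ^ 2 / M := fun y => by
    simp only [hT]
    rw [le_div_iff₀ hMpos]
    rcases le_total M y with h | h
    · rw [min_eq_left h, max_eq_right (by linarith), abs_of_nonneg (by linarith)]
      nlinarith
    · rw [min_eq_right h]
      rcases le_total (-M) y with h' | h'
      · rw [max_eq_right h']; simp; positivity
      · rw [max_eq_left h', abs_of_nonpos (by linarith)]
        nlinarith
  have hTlim : Tendsto (fun n => ∫ ω, T (Y n ω) ∂P) atTop (nhds (∫ ω, Z ω ∂P)) := by
    have := tendsto_integral_of_dominated_convergence (μ := P) (F := fun n ω => T (Y n ω))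
      (f := fun ω => T (Z ω)) (fun _ => M)
      (fun n => (hTc.measurable.comp (hY n)).aestronglyMeasurable)
      (integrable_const M) (fun n => Eventually.of_forall fun ω => hTb _)
      (hlim.mono fun ω h => (hTc.tendsto _).comp h)
    simpa only [hTZ] using this
  have h1 := (Metric.tendsto_nhds.1 hTlim (ε / 2) (by positivity)).and hC
  rw [eventually_atTop] at h1
  obtain ⟨n0, hn0⟩ := h1
  refine ⟨n0, fun n hn => ?_⟩
  obtain ⟨hd1, hint, hle⟩ := hn0 n hn.le
  have hTi : Integrable (fun ω => T (Y n ω)) P :=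
    Integrable.of_bound (hTc.measurable.comp (hY n)).aestronglyMeasurable M
      (Eventually.of_forall fun ω => hTb _)
  have hdi : Integrable (fun ω => Y n ω - T (Y n ω)) P :=
    (hint.div_const M).mono' ((hY n).sub (hTc.measurable.comp (hY n))).aestronglyMeasurable
      (Eventually.of_forall fun ω => hTd _)
  have hYi : Integrable (Y n) P := by
    have := hdi.add hTi
    refine this.congr (Eventually.of_forall fun ω => by simp)
  have hdist : dist (∫ ω, Y n ω ∂P) (∫ ω, T (Y n ω) ∂P) ≤ C / M := by
    rw [Real.dist_eq, ← integral_sub hYi hTi]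
    calc _ ≤ ∫ ω, |Y n ω - T (Y n ω)| ∂P := abs_integral_le_integral_abs
      _ ≤ ∫ ω, Y n ω ^ 2 / M ∂P :=
          integral_mono hdi.abs (hint.div_const M) fun ω => hTd _
      _ = (∫ ω, Y n ω ^ 2 ∂P) / M := integral_div _ _
      _ ≤ C / M := by gcongr
  have hCM : C / M < ε / 2 := by
    rw [div_lt_iff₀ hMpos, hM]
    have : ε / 2 * (b + 2 * C / ε + 1) = ε / 2 * b + C + ε / 2 := by field_simp
    rw [this]
    have : 0 ≤ ε / 2 * b := by positivity
    linarith
  linarith [dist_triangle (∫ ω, Y n ω ∂P) (∫ ω, T (Y n ω) ∂P) (∫ ω, Z ω ∂P)]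

/-- If `X⁻²` has a finite moment of some small order, then the inverse of the empirical second
moment of independent copies of `X` is bounded in mean. -/
lemma lintegral_div_sum_sq_le {E : Type*} [NormedAddCommGroup E] [MeasurableSpace E]
    [OpensMeasurableSpace E] (ρ : Measure E) [IsProbabilityMeasure ρ] (hρ0 : ρ {0} = 0)
    {n₀ n : ℕ} (hn₀ : 1 ≤ n₀) (hn : n₀ ≤ n) :
    ∫⁻ ω, ENNReal.ofReal (n / ∑ i ∈ Finset.range n, ‖ω i‖ ^ 2) ∂(Measure.infinitePi fun _ : ℕ => ρ)
      ≤ (∫⁻ x, ENNReal.ofReal (‖x‖ ^ (-(2 : ℝ) / n₀)) ∂ρ) ^ n₀ := by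
  have hn0 : (0 : ℝ) < n := by exact_mod_cast (by omega : 0 < n)
  have hn0' : (0 : ℝ) < n₀ := by exact_mod_cast hn₀
  have hae0 : ∀ᵐ x ∂ρ, x ≠ 0 := by
    rw [ae_iff]; simpa using hρ0
  have hae : ∀ᵐ ω ∂(Measure.infinitePi fun _ : ℕ => ρ), ∀ i, ω i ≠ 0 := by
    rw [ae_all_iff]
    intro i
    exact (measurePreserving_eval_infinitePi (fun _ : ℕ => ρ) i).quasiMeasurePreserving.ae hae0
  have hind : ProbabilityTheory.iIndepFun
      (fun i (ω : ℕ → E) => ENNReal.ofReal (‖ω i‖ ^ (-(2 : ℝ) / n)))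
      (Measure.infinitePi fun _ : ℕ => ρ) :=
    ProbabilityTheory.iIndepFun_infinitePi (P := fun _ : ℕ => ρ)
      (X := fun _ x => ENNReal.ofReal (‖x‖ ^ (-(2 : ℝ) / n))) (fun _ => by fun_prop)
  calc ∫⁻ ω, ENNReal.ofReal (n / ∑ i ∈ Finset.range n, ‖ω i‖ ^ 2) ∂(Measure.infinitePi fun _ : ℕ => ρ)
      ≤ ∫⁻ ω, ∏ i ∈ Finset.range n, ENNReal.ofReal (‖ω i‖ ^ (-(2 : ℝ) / n))
          ∂(Measure.infinitePi fun _ : ℕ => ρ) := by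
        refine lintegral_mono_ae (hae.mono fun ω hω => ?_)
        rw [← ENNReal.ofReal_prod_of_nonneg fun i _ => by positivity]
        apply ENNReal.ofReal_le_ofReal
        have h := Real.geom_mean_le_arith_mean_weighted (Finset.range n) (fun _ => 1 / (n : ℝ))
          (fun i => ‖ω i‖ ^ 2) (fun _ _ => by positivity) (by simp; field_simp)
          (fun _ _ => by positivity)
        rw [← Finset.mul_sum] at h
        have hpos : 0 < ∏ i ∈ Finset.range n, (‖ω i‖ ^ 2) ^ (1 / (n : ℝ)) :=
          Finset.prod_pos fun i _ => by
            have := norm_pos_iff.2 (hω i)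
            positivity
        have h2 := one_div_le_one_div_of_le hpos h
        have e1 : (n : ℝ) / ∑ i ∈ Finset.range n, ‖ω i‖ ^ 2 =
            1 / (1 / (n : ℝ) * ∑ i ∈ Finset.range n, ‖ω i‖ ^ 2) := by
          rw [one_div_mul_eq_div, one_div_div]
        rw [e1]
        refine h2.trans_eq ?_
        rw [one_div, ← Finset.prod_inv_distrib]
        refine Finset.prod_congr rfl fun i _ => ?_
        have := norm_pos_iff.2 (hω i)
        rw [← Real.rpow_natCast, ← Real.rpow_mul this.le, ← Real.rpow_neg this.le]
        congr 1
        push_cast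
        ring
    _ = ∏ i ∈ Finset.range n, ∫⁻ x, ENNReal.ofReal (‖x‖ ^ (-(2 : ℝ) / n)) ∂ρ := by
        rw [ProbabilityTheory.lintegral_prod_eq_prod_lintegral_of_indepFun _ _ hind
          (fun i => by fun_prop)]
        refine Finset.prod_congr rfl fun i _ => ?_
        exact (measurePreserving_eval_infinitePi (fun _ : ℕ => ρ) i).lintegral_comp
          (f := fun x => ENNReal.ofReal (‖x‖ ^ (-(2 : ℝ) / n))) (by fun_prop)
    _ = (∫⁻ x, ENNReal.ofReal (‖x‖ ^ (-(2 : ℝ) / n)) ∂ρ) ^ n := by simp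
    _ ≤ _ := by
        have h := eLpNorm'_le_eLpNorm'_of_exponent_le (f := fun x : E => ‖x‖ ^ (-2 : ℝ))
          (p := 1 / (n : ℝ)) (q := 1 / (n₀ : ℝ)) (by positivity)
          (one_div_le_one_div_of_le hn0' (by exact_mod_cast hn)) ρ
          (Measurable.aestronglyMeasurable (by fun_prop))
        have key : ∀ m : ℕ, (0 : ℝ) < m → eLpNorm' (fun x : E => ‖x‖ ^ (-2 : ℝ)) (1 / (m : ℝ)) ρ =
            (∫⁻ x, ENNReal.ofReal (‖x‖ ^ (-(2 : ℝ) / m)) ∂ρ) ^ m := by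
          intro m hm
          rw [eLpNorm', one_div_one_div, ENNReal.rpow_natCast]
          congr 1
          refine lintegral_congr fun x => ?_
          rw [Real.enorm_of_nonneg (by positivity), ENNReal.ofReal_rpow_of_nonneg (by positivity)
            (by positivity), ← Real.rpow_mul (norm_nonneg _)]
          congr 2
          ring
        rwa [key n hn0, key n₀ hn0'] at h

lemma volume_preserving_euclideanSpace_curry (m d : ℕ) :
    MeasurePreserving (fun (y : EuclideanSpace ℝ (Fin m × Fin d)) (l : Fin m) =>
      (WithLp.toLp 2 fun j => y (l, j) : EuclideanSpace ℝ (Fin d))) := by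
  have h1 : MeasurePreserving (MeasurableEquiv.curry (Fin m) (Fin d) ℝ).symm := by
    refine ⟨(MeasurableEquiv.curry (Fin m) (Fin d) ℝ).symm.measurable, ?_⟩
    refine (Measure.pi_eq fun s hs => ?_).symm
    rw [MeasurableEquiv.map_apply]
    have : (MeasurableEquiv.curry (Fin m) (Fin d) ℝ).symm ⁻¹' Set.univ.pi s =
        Set.univ.pi fun l => Set.univ.pi fun j => s (l, j) := by
      ext x
      simp [Set.mem_pi, Function.uncurry]
    rw [this, volume_pi_pi]
    simp_rw [volume_pi_pi]
    rw [Fintype.prod_prod_type]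
  have h2 : MeasurePreserving (fun (x : Fin m → Fin d → ℝ) (l : Fin m) =>
      (WithLp.toLp 2 (x l) : EuclideanSpace ℝ (Fin d))) :=
    volume_preserving_pi fun _ => PiLp.volume_preserving_toLp (Fin d)
  exact (h2.comp (h1.symm (MeasurableEquiv.curry (Fin m) (Fin d) ℝ).symm)).comp
    (PiLp.volume_preserving_ofLp (Fin m × Fin d))

/-- The probability density proportional to `exp (-‖x‖ ^ p)`, as a measure. -/
noncomputable def expPowMeasure (d : ℕ) (p c : ℝ) : Measure (EuclideanSpace ℝ (Fin d)) :=
  volume.withDensity fun x => ENNReal.ofReal (c⁻¹ * exp (-‖x‖ ^ p))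

lemma map_infinitePi_expPowMeasure {ι : Type*} [Fintype ι] {d : ℕ} {p c : ℝ} (hc : 0 < c)
    (hi : Integrable fun x : EuclideanSpace ℝ (Fin d) => exp (-‖x‖ ^ p))
    [IsProbabilityMeasure (expPowMeasure d p c)] {e : ι → ℕ} (he : Function.Injective e) :
    (Measure.infinitePi fun _ : ℕ => expPowMeasure d p c).map (fun ω i => ω (e i)) =
      volume.withDensity fun x => ENNReal.ofReal (∏ i, c⁻¹ * exp (-‖x i‖ ^ p)) := by
  rw [map_infinitePi_comp_injective _ he]
  exact pi_withDensity_ofReal (ι := ι) volume (f := fun x => c⁻¹ * exp (-‖x‖ ^ p))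
    (fun x => by positivity) (hi.const_mul _)

lemma lintegral_infinitePi_expPowMeasure {d k m : ℕ} {p c : ℝ} (hc : 0 < c)
    (hi : Integrable fun x : EuclideanSpace ℝ (Fin d) => exp (-‖x‖ ^ p))
    [IsProbabilityMeasure (expPowMeasure d p c)]
    {H : (Fin k → EuclideanSpace ℝ (Fin d)) → ℝ → ENNReal} (hH : Measurable (Function.uncurry H)) :
    ∫⁻ ω, H (fun i => ω i) (∑ i ∈ Finset.range (k + m), ‖ω i‖ ^ 2)
        ∂(Measure.infinitePi fun _ : ℕ => expPowMeasure d p c) =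
      ENNReal.ofReal (c⁻¹ ^ (k + m)) * ∫⁻ x, ∫⁻ y : EuclideanSpace ℝ (Fin m × Fin d),
        H x (∑ i, ‖x i‖ ^ 2 + ‖y‖ ^ 2) * ENNReal.ofReal (exp (-(∑ i, ‖x i‖ ^ p +
          ∑ l, √(∑ j, y (l, j) ^ 2) ^ p))) := by
  set e : Fin k ⊕ Fin m → ℕ := fun s => (finSumFinEquiv s : ℕ) with he_def
  have he : Function.Injective e := fun a b h => finSumFinEquiv.injective (Fin.val_injective h)
  have hmap := map_infinitePi_expPowMeasure (ι := Fin k ⊕ Fin m) hc hi he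
  set G : (Fin k ⊕ Fin m → EuclideanSpace ℝ (Fin d)) → ENNReal := fun z =>
    H (fun i => z (Sum.inl i)) (∑ i, ‖z (Sum.inl i)‖ ^ 2 + ∑ l, ‖z (Sum.inr l)‖ ^ 2) with hG
  have hGm : Measurable G := hH.comp (f := fun z : Fin k ⊕ Fin m → EuclideanSpace ℝ (Fin d) =>
    ((fun i => z (Sum.inl i)), (∑ i, ‖z (Sum.inl i)‖ ^ 2 + ∑ l, ‖z (Sum.inr l)‖ ^ 2)))
    (by fun_prop)
  have h1 : ∫⁻ ω, H (fun i => ω i) (∑ i ∈ Finset.range (k + m), ‖ω i‖ ^ 2)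
        ∂(Measure.infinitePi fun _ : ℕ => expPowMeasure d p c) =
      ∫⁻ z, G z ∂((Measure.infinitePi fun _ : ℕ => expPowMeasure d p c).map
        (fun ω i => ω (e i))) := by
    rw [lintegral_map hGm (by fun_prop)]
    refine lintegral_congr fun ω => ?_
    simp only [hG, he_def, finSumFinEquiv_apply_left, finSumFinEquiv_apply_right,
      Fin.val_castAdd]
    rw [Finset.sum_range, Fin.sum_univ_add]
    simp
  have hden : Measurable fun z : Fin k ⊕ Fin m → EuclideanSpace ℝ (Fin d) =>
    ENNReal.ofReal (∏ i, c⁻¹ * exp (-‖z i‖ ^ p)) := by fun_prop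
  rw [h1, hmap, lintegral_withDensity_eq_lintegral_mul _ hden hGm]
  have hpres := volume_measurePreserving_sumPiEquivProdPi
    (fun _ : Fin k ⊕ Fin m => EuclideanSpace ℝ (Fin d))
  set G2 : (Fin k → EuclideanSpace ℝ (Fin d)) × (Fin m → EuclideanSpace ℝ (Fin d)) → ENNReal :=
    fun z => ENNReal.ofReal (c⁻¹ ^ (k + m)) * (H z.1 (∑ i, ‖z.1 i‖ ^ 2 + ∑ l, ‖z.2 l‖ ^ 2) *
      ENNReal.ofReal (exp (-(∑ i, ‖z.1 i‖ ^ p + ∑ l, ‖z.2 l‖ ^ p)))) with hG2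
  have hG2m : Measurable G2 := by
    have : Measurable fun z : (Fin k → EuclideanSpace ℝ (Fin d)) ×
        (Fin m → EuclideanSpace ℝ (Fin d)) => H z.1 (∑ i, ‖z.1 i‖ ^ 2 + ∑ l, ‖z.2 l‖ ^ 2) :=
      hH.comp (f := fun z : (Fin k → EuclideanSpace ℝ (Fin d)) ×
        (Fin m → EuclideanSpace ℝ (Fin d)) => (z.1, (∑ i, ‖z.1 i‖ ^ 2 + ∑ l, ‖z.2 l‖ ^ 2)))
        (by fun_prop)
    exact (this.mul (by fun_prop)).const_mul _
  have h2 : ∫⁻ z : Fin k ⊕ Fin m → EuclideanSpace ℝ (Fin d),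
      ((fun z : Fin k ⊕ Fin m → EuclideanSpace ℝ (Fin d) =>
        ENNReal.ofReal (∏ i, c⁻¹ * exp (-‖z i‖ ^ p))) * G) z = ∫⁻ z, G2 z := by
    rw [← hpres.lintegral_comp hG2m]
    refine lintegral_congr fun z => ?_
    simp only [Pi.mul_apply, hG2, hG]
    change _ = ENNReal.ofReal (c⁻¹ ^ (k + m)) * (H (fun i => z (Sum.inl i))
      (∑ i, ‖z (Sum.inl i)‖ ^ 2 + ∑ l, ‖z (Sum.inr l)‖ ^ 2) *
      ENNReal.ofReal (exp (-(∑ i, ‖z (Sum.inl i)‖ ^ p + ∑ l, ‖z (Sum.inr l)‖ ^ p))))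
    rw [mul_left_comm, ← ENNReal.ofReal_mul (by positivity), mul_comm]
    congr 2
    rw [Finset.prod_mul_distrib, ← Real.exp_sum, Fintype.sum_sum_type, neg_add,
      ← Finset.sum_neg_distrib, ← Finset.sum_neg_distrib]
    simp
  rw [h2, Measure.volume_eq_prod, lintegral_prod _ hG2m.aemeasurable, ← lintegral_const_mul']
  · refine lintegral_congr fun x => ?_
    have hx : Measurable fun y => G2 (x, y) := hG2m.comp measurable_prodMk_left
    rw [← (volume_preserving_euclideanSpace_curry m d).lintegral_comp hx, ← lintegral_const_mul']
    · refine lintegral_congr fun y => ?_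
      simp only [hG2, EuclideanSpace.norm_eq, Real.norm_eq_abs, sq_abs]
      simp_rw [Real.sq_sqrt (Finset.sum_nonneg fun _ _ => sq_nonneg _)]
      rw [Fintype.sum_prod_type]
    · exact ENNReal.ofReal_ne_top
  · exact ENNReal.ofReal_ne_top

/-- The unnormalised `k`-particle marginal at `N = k + m` particles. -/
noncomputable def sphereMarginal (d k m : ℕ) (p N n : ℝ) (u : Fin k → EuclideanSpace ℝ (Fin d)) :
    ℝ :=
  √(N / (N - ∑ i, ‖u i‖ ^ 2)) * (√(N - ∑ i, ‖u i‖ ^ 2) ^ (d * m - 1) *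
    ∫ ω : Metric.sphere (0 : EuclideanSpace ℝ (Fin m × Fin d)) 1,
      ((∑ i, ‖u i‖ ^ p) + ∑ l : Fin m, (√(N - ∑ i, ‖u i‖ ^ 2) *
        √(∑ j, ((ω : EuclideanSpace ℝ (Fin m × Fin d)) (l, j)) ^ 2)) ^ p) ^ (-(n - 1) / p)
      ∂volume.toSphere)

lemma sphereMarginal_nonneg (d k m : ℕ) (p N n : ℝ) (u : Fin k → EuclideanSpace ℝ (Fin d)) :
    0 ≤ sphereMarginal d k m p N n u := by
  refine mul_nonneg (sqrt_nonneg _) (mul_nonneg (by positivity) (integral_nonneg fun ω => ?_))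
  simp only [Pi.zero_apply]
  positivity

lemma measurable_sphereMarginal (d k m : ℕ) (p N n : ℝ) :
    Measurable (sphereMarginal d k m p N n) := by
  have : Measurable fun z : (Fin k → EuclideanSpace ℝ (Fin d)) ×
      Metric.sphere (0 : EuclideanSpace ℝ (Fin m × Fin d)) 1 =>
      ((∑ i, ‖z.1 i‖ ^ p) + ∑ l : Fin m, (√(N - ∑ i, ‖z.1 i‖ ^ 2) *
        √(∑ j, ((z.2 : EuclideanSpace ℝ (Fin m × Fin d)) (l, j)) ^ 2)) ^ p) ^ (-(n - 1) / p) := by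
    fun_prop
  have h := (this.stronglyMeasurable.integral_prod_right' (ν := volume.toSphere)).measurable
  unfold sphereMarginal
  fun_prop

lemma lintegral_sphereMarginal {d k m : ℕ} (hd : 1 ≤ d) (hm : 1 ≤ m) {p c N n : ℝ} (hp : 0 < p)
    (hc : 0 < c) (hi : Integrable fun x : EuclideanSpace ℝ (Fin d) => exp (-‖x‖ ^ p))
    [IsProbabilityMeasure (expPowMeasure d p c)] (hN : N = k + m) (hn : n = d * N) (hn1 : 1 < n)
    {g : (Fin k → EuclideanSpace ℝ (Fin d)) → ENNReal} (hg : Measurable g) :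
    (∫⁻ u in {u | ∑ i, ‖u i‖ ^ 2 < N}, g u * ENNReal.ofReal (sphereMarginal d k m p N n u)) *
      ENNReal.ofReal (c⁻¹ ^ (k + m) * ((1 / p) * Gamma ((n - 1) / p))) =
    ∫⁻ ω, g ((√N / √(∑ i ∈ Finset.range (k + m), ‖ω i‖ ^ 2)) • fun i : Fin k => ω i) *
      ENNReal.ofReal (√(∑ i ∈ Finset.range (k + m), ‖ω i‖ ^ 2))⁻¹
      ∂(Measure.infinitePi fun _ : ℕ => expPowMeasure d p c) := by
  have : Nonempty (Fin m × Fin d) := ⟨⟨⟨0, hm⟩, ⟨0, hd⟩⟩⟩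
  have hfin : Module.finrank ℝ (EuclideanSpace ℝ (Fin m × Fin d)) = d * m := by
    simp [mul_comm]
  have hfinV : Module.finrank ℝ (Fin k → EuclideanSpace ℝ (Fin d)) = k * d := by
    rw [Module.finrank_pi_fintype]
    simp
  have hN0 : 0 < N := by
    have : (1 : ℝ) ≤ m := by exact_mod_cast hm
    rw [hN]; positivity
  set A : EuclideanSpace ℝ (Fin m × Fin d) → ℝ := fun y => ∑ l, √(∑ j, y (l, j) ^ 2) ^ p with hA
  have key := lintegral_sphere_marginal (V := Fin k → EuclideanSpace ℝ (Fin d))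
    (W := EuclideanSpace ℝ (Fin m × Fin d)) volume volume (p := p) (N := N) (n := n) hp hN0
    (by rw [hfin, hfinV, hn, hN]; push_cast; ring) hn1
    (q := fun u => ∑ i, ‖u i‖ ^ 2) (B := fun u => ∑ i, ‖u i‖ ^ p) (by fun_prop) (by fun_prop)
    (fun u => by positivity) (fun u => by positivity)
    (fun R hR u => by
      simp only [Pi.smul_apply, norm_smul, mul_pow, Finset.mul_sum, Real.norm_of_nonneg hR.le])
    (fun R hR u => by
      simp only [Pi.smul_apply, norm_smul, Real.mul_rpow hR.le (norm_nonneg _), Finset.mul_sum,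
        Real.norm_of_nonneg hR.le])
    (A := A)
    (continuous_finsetSum _ fun l _ => Continuous.rpow_const (by fun_prop)
      fun _ => Or.inr hp.le)
    (fun y hy => by
      obtain ⟨⟨l, j⟩, hlj⟩ : ∃ z, y z ≠ 0 := by
        by_contra h
        push Not at h
        exact hy (by ext z; simpa using h z)
      refine Finset.sum_pos' (fun _ _ => by positivity) ⟨l, Finset.mem_univ _, ?_⟩
      refine Real.rpow_pos_of_pos (Real.sqrt_pos.2 ?_) _
      exact Finset.sum_pos' (fun _ _ => sq_nonneg _) ⟨j, Finset.mem_univ _, by positivity⟩)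
    (fun R hR y => by
      simp only [hA, PiLp.smul_apply, smul_eq_mul, mul_pow, ← Finset.mul_sum]
      simp_rw [Real.sqrt_mul (sq_nonneg R), Real.sqrt_sq hR.le,
        Real.mul_rpow hR.le (sqrt_nonneg _)]
      rw [Finset.mul_sum])
    hg
  have hS : ∀ u : Fin k → EuclideanSpace ℝ (Fin d), sphereMarginal d k m p N n u =
      √(N / (N - ∑ i, ‖u i‖ ^ 2)) * (√(N - ∑ i, ‖u i‖ ^ 2) ^
        (Module.finrank ℝ (EuclideanSpace ℝ (Fin m × Fin d)) - 1) *
        ∫ ω : Metric.sphere (0 : EuclideanSpace ℝ (Fin m × Fin d)) 1,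
          (∑ i, ‖u i‖ ^ p + √(N - ∑ i, ‖u i‖ ^ 2) ^ p * A ω) ^ (-(n - 1) / p)
          ∂volume.toSphere) := by
    intro u
    simp only [sphereMarginal, Real.mul_rpow (sqrt_nonneg _) (sqrt_nonneg _), ← Finset.mul_sum,
      hfin, hA]
  simp_rw [← hS] at key
  have hCγ : 0 ≤ (1 / p) * Gamma ((n - 1) / p) := by
    have := Gamma_pos_of_pos (show 0 < (n - 1) / p from div_pos (by linarith) hp)
    positivity
  have hH : Measurable (Function.uncurry fun (x : Fin k → EuclideanSpace ℝ (Fin d)) (Q : ℝ) =>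
      g ((√N / √Q) • x) * ENNReal.ofReal (√Q)⁻¹) := by
    have : Measurable fun z : (Fin k → EuclideanSpace ℝ (Fin d)) × ℝ => g ((√N / √z.2) • z.1) :=
      hg.comp (by fun_prop)
    exact this.mul (by fun_prop)
  rw [lintegral_infinitePi_expPowMeasure (k := k) (m := m)
    (H := fun x Q => g ((√N / √Q) • x) * ENNReal.ofReal (√Q)⁻¹) hc hi hH,
    ENNReal.ofReal_mul (by positivity), mul_left_comm, key]
  congr 1
  refine lintegral_congr fun x => lintegral_congr fun y => ?_
  rw [ENNReal.ofReal_mul (by positivity), mul_assoc]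

lemma integral_mul_eq_of_lintegral_mul_eq {V Ω : Type*} [MeasurableSpace V] [MeasurableSpace Ω]
    {ν : Measure V} {P : Measure Ω} {T : Ω → V} (hT : Measurable T) {w : Ω → ℝ}
    (hw : Measurable w) (hw0 : ∀ ω, 0 ≤ w ω) {h : V → ℝ} (hh : Measurable h) (hh0 : ∀ x, 0 ≤ h x)
    {z : ℝ} (hz : 0 ≤ z)
    (H : ∀ g : V → ENNReal, Measurable g →
      (∫⁻ x, g x * ENNReal.ofReal (h x) ∂ν) * ENNReal.ofReal z =
        ∫⁻ ω, g (T ω) * ENNReal.ofReal (w ω) ∂P) {φ : V → ℝ} (hφ : Measurable φ) :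
    (∫ x, φ x * h x ∂ν) * z = ∫ ω, φ (T ω) * w ω ∂P := by
  have hm : ENNReal.ofReal z • ν.withDensity (fun x => ENNReal.ofReal (h x)) =
      (P.withDensity fun ω => ENNReal.ofReal (w ω)).map T := by
    ext s hs
    have h1 := H (s.indicator 1) (measurable_one.indicator hs)
    have h2 : ∀ x, s.indicator (1 : V → ENNReal) x * ENNReal.ofReal (h x) =
        s.indicator (fun x => ENNReal.ofReal (h x)) x := fun x => by
      by_cases hx : x ∈ s <;> simp [hx]
    have h3 : ∀ ω, s.indicator (1 : V → ENNReal) (T ω) * ENNReal.ofReal (w ω) =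
        (T ⁻¹' s).indicator (fun ω => ENNReal.ofReal (w ω)) ω := fun ω => by
      by_cases hx : T ω ∈ s <;> simp [hx]
    simp_rw [h2, h3] at h1
    rw [lintegral_indicator hs, lintegral_indicator (hT hs)] at h1
    rw [Measure.smul_apply, smul_eq_mul, mul_comm, withDensity_apply _ hs, h1,
      Measure.map_apply hT hs, withDensity_apply _ (hT hs)]
  have h1 : ∫ x, φ x * h x ∂ν = ∫ x, φ x ∂(ν.withDensity fun x => ENNReal.ofReal (h x)) := by
    rw [integral_withDensity_eq_integral_toReal_smul (by fun_prop) (by simp)]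
    refine integral_congr_ae (.of_forall fun x => ?_)
    simp [ENNReal.toReal_ofReal (hh0 x), mul_comm]
  have h2 : ∫ ω, φ (T ω) * w ω ∂P =
      ∫ ω, φ (T ω) ∂(P.withDensity fun ω => ENNReal.ofReal (w ω)) := by
    rw [integral_withDensity_eq_integral_toReal_smul (by fun_prop) (by simp)]
    refine integral_congr_ae (.of_forall fun x => ?_)
    simp [ENNReal.toReal_ofReal (hw0 x), mul_comm]
  rw [h1, h2, ← integral_map hT.aemeasurable hφ.aestronglyMeasurable, ← hm, integral_smul_measure,
    ENNReal.toReal_ofReal hz, smul_eq_mul, mul_comm]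

lemma integral_mul_sphereMarginal {d k m : ℕ} (hd : 1 ≤ d) (hm : 1 ≤ m) {p c N n : ℝ} (hp : 0 < p)
    (hc : 0 < c) (hi : Integrable fun x : EuclideanSpace ℝ (Fin d) => exp (-‖x‖ ^ p))
    [IsProbabilityMeasure (expPowMeasure d p c)] (hN : N = k + m) (hn : n = d * N) (hn1 : 1 < n)
    {φ : (Fin k → EuclideanSpace ℝ (Fin d)) → ℝ} (hφ : Measurable φ) :
    (∫ u in {u | ∑ i, ‖u i‖ ^ 2 < N}, φ u * sphereMarginal d k m p N n u) *
      (c⁻¹ ^ (k + m) * ((1 / p) * Gamma ((n - 1) / p))) =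
    ∫ ω, φ ((√N / √(∑ i ∈ Finset.range (k + m), ‖ω i‖ ^ 2)) • fun i : Fin k => ω i) *
      (√(∑ i ∈ Finset.range (k + m), ‖ω i‖ ^ 2))⁻¹
      ∂(Measure.infinitePi fun _ : ℕ => expPowMeasure d p c) := by
  have hG := Gamma_pos_of_pos (show 0 < (n - 1) / p from div_pos (by linarith) hp)
  exact integral_mul_eq_of_lintegral_mul_eq
    (T := fun ω : ℕ → EuclideanSpace ℝ (Fin d) =>
      (√N / √(∑ i ∈ Finset.range (k + m), ‖ω i‖ ^ 2)) • fun i : Fin k => ω i)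
    (w := fun ω : ℕ → EuclideanSpace ℝ (Fin d) =>
      (√(∑ i ∈ Finset.range (k + m), ‖ω i‖ ^ 2))⁻¹) (by fun_prop) (by fun_prop)
    (fun ω => by positivity) (measurable_sphereMarginal d k m p N n)
    (sphereMarginal_nonneg d k m p N n) (by positivity)
    (fun g hg => lintegral_sphereMarginal hd hm hp hc hi hN hn hn1 hg) hφ

lemma integral_sphere_mul {d N : ℕ} (hd : 1 ≤ d) (hN : 1 ≤ N) {p c : ℝ} (hp : 0 < p)
    (hc : 0 < c) (hi : Integrable fun x : EuclideanSpace ℝ (Fin d) => exp (-‖x‖ ^ p))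
    [IsProbabilityMeasure (expPowMeasure d p c)] (hn1 : 1 < (d * N : ℝ)) :
    (√N ^ (d * N - 1) * ∫ ω : Metric.sphere (0 : EuclideanSpace ℝ (Fin N × Fin d)) 1,
      (∑ l : Fin N, (√N * √(∑ j, ((ω : EuclideanSpace ℝ (Fin N × Fin d)) (l, j)) ^ 2)) ^ p) ^
        (-((d * N : ℝ) - 1) / p) ∂volume.toSphere) *
      (c⁻¹ ^ N * ((1 / p) * Gamma ((d * N - 1) / p))) =
    ∫ ω, (√(∑ i ∈ Finset.range N, ‖ω i‖ ^ 2))⁻¹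
      ∂(Measure.infinitePi fun _ : ℕ => expPowMeasure d p c) := by
  have h := integral_mul_sphereMarginal (k := 0) (m := N) (N := N) hd hN hp hc hi (by simp) rfl
    hn1 (φ := fun _ => 1) measurable_const
  have hN0 : (0 : ℝ) < N := by exact_mod_cast hN
  have h1 : (volume : Measure (Fin 0 → EuclideanSpace ℝ (Fin d))).real Set.univ = 1 := by
    rw [measureReal_def, ← Set.pi_univ (Set.univ : Set (Fin 0)), volume_pi_pi]
    simp
  simpa [hN0, hN0.ne', h1, sphereMarginal] using h

lemma integrable_exp_neg_norm_rpow {d : ℕ} (hd : 1 ≤ d) {p : ℝ} (hp : 0 < p) :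
    Integrable fun x : EuclideanSpace ℝ (Fin d) => exp (-‖x‖ ^ p) := by
  have : Nonempty (Fin d) := ⟨⟨0, hd⟩⟩
  have hd' : (0 : ℝ) < d := by exact_mod_cast hd
  simpa using (integrable_norm_rpow_mul_exp_neg
    (volume : Measure (EuclideanSpace ℝ (Fin d))) (s := 0) hp (by simpa using hd')).1

lemma integral_exp_neg_norm_rpow_pos {d : ℕ} (hd : 1 ≤ d) {p : ℝ} (hp : 0 < p) :
    0 < ∫ x : EuclideanSpace ℝ (Fin d), exp (-‖x‖ ^ p) :=
  integral_exp_pos (integrable_exp_neg_norm_rpow hd hp)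

lemma isProbabilityMeasure_expPowMeasure {d : ℕ} (hd : 1 ≤ d) {p : ℝ} (hp : 0 < p) :
    IsProbabilityMeasure
      (expPowMeasure d p (∫ x : EuclideanSpace ℝ (Fin d), exp (-‖x‖ ^ p))) := by
  have hc := integral_exp_neg_norm_rpow_pos hd hp
  refine ⟨?_⟩
  rw [expPowMeasure, withDensity_apply _ .univ, setLIntegral_univ,
    ← ofReal_integral_eq_lintegral_ofReal ((integrable_exp_neg_norm_rpow hd hp).const_mul _)
      (.of_forall fun x => by positivity), integral_const_mul, inv_mul_cancel₀ hc.ne',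
    ENNReal.ofReal_one]

lemma integrable_norm_rpow_expPowMeasure {d : ℕ} (hd : 1 ≤ d) {p s : ℝ} (hp : 0 < p)
    (hs : 0 < d + s) :
    Integrable (fun x => ‖x‖ ^ s)
        (expPowMeasure d p (∫ x : EuclideanSpace ℝ (Fin d), exp (-‖x‖ ^ p))) ∧
      ∫ x, ‖x‖ ^ s ∂(expPowMeasure d p (∫ x : EuclideanSpace ℝ (Fin d), exp (-‖x‖ ^ p))) =
        Gamma ((d + s) / p) / Gamma (d / p) := by
  have : Nonempty (Fin d) := ⟨⟨0, hd⟩⟩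
  have hd' : (0 : ℝ) < d := by exact_mod_cast hd
  have hc := integral_exp_neg_norm_rpow_pos hd hp
  have h0 := (integrable_norm_rpow_mul_exp_neg
    (volume : Measure (EuclideanSpace ℝ (Fin d))) (s := 0) hp (by simpa using hd')).2
  obtain ⟨h1, h2⟩ := integrable_norm_rpow_mul_exp_neg
    (volume : Measure (EuclideanSpace ℝ (Fin d))) (s := s) hp (by simpa using hs)
  simp only [rpow_zero, one_mul, add_zero, finrank_euclideanSpace, Fintype.card_fin] at h0 h2
  set c := ∫ x : EuclideanSpace ℝ (Fin d), exp (-‖x‖ ^ p) with hcdef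
  have hm : Measurable fun x : EuclideanSpace ℝ (Fin d) =>
    ENNReal.ofReal (c⁻¹ * exp (-‖x‖ ^ p)) := by fun_prop
  have heq : (fun x : EuclideanSpace ℝ (Fin d) =>
      (ENNReal.ofReal (c⁻¹ * exp (-‖x‖ ^ p))).toReal • ‖x‖ ^ s) =
      fun x => c⁻¹ * (‖x‖ ^ s * exp (-‖x‖ ^ p)) := by
    ext x
    rw [ENNReal.toReal_ofReal (by positivity), smul_eq_mul]
    ring
  refine ⟨?_, ?_⟩
  · rw [expPowMeasure, integrable_withDensity_iff_integrable_smul' hm (by simp), heq]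
    exact h1.const_mul _
  · rw [expPowMeasure, integral_withDensity_eq_integral_toReal_smul hm (by simp), heq,
      integral_const_mul, h2]
    rw [h0] at hc ⊢
    have hne := hc.ne'
    have hG : Gamma (d / p) ≠ 0 := by
      intro h; simp [h] at hne
    have hpos := right_ne_zero_of_mul (left_ne_zero_of_mul hne)
    field_simp

lemma ae_tendsto_sum_norm_sq_div {d : ℕ} (hd : 1 ≤ d) {p : ℝ} (hp : 0 < p) :
    ∀ᵐ ω ∂(Measure.infinitePi fun _ : ℕ =>
        expPowMeasure d p (∫ x : EuclideanSpace ℝ (Fin d), exp (-‖x‖ ^ p))),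
      Tendsto (fun N : ℕ => (∑ i ∈ Finset.range N, ‖ω i‖ ^ 2) / N) atTop
        (nhds (Gamma ((d + 2) / p) / Gamma (d / p))) := by
  have := isProbabilityMeasure_expPowMeasure hd hp
  set ρ := expPowMeasure d p (∫ x : EuclideanSpace ℝ (Fin d), exp (-‖x‖ ^ p)) with hρ
  obtain ⟨h1, h2⟩ := integrable_norm_rpow_expPowMeasure hd hp (s := 2) (by positivity)
  rw [← hρ] at h1 h2
  simp only [Real.rpow_two] at h1 h2
  have hev (i : ℕ) := measurePreserving_eval_infinitePi (fun _ : ℕ => ρ) i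
  have h := ProbabilityTheory.strong_law_ae_real (μ := Measure.infinitePi fun _ : ℕ => ρ)
    (fun i ω => ‖ω i‖ ^ 2) ((hev 0).integrable_comp_of_integrable h1)
    (fun i j hij => (ProbabilityTheory.iIndepFun_infinitePi (P := fun _ : ℕ => ρ)
      (X := fun _ x => ‖x‖ ^ 2) (fun _ => by fun_prop)).indepFun hij)
    (fun i => by
      have hid : ProbabilityTheory.IdentDistrib (fun ω : ℕ → EuclideanSpace ℝ (Fin d) => ω i)
          (fun ω => ω 0) (Measure.infinitePi fun _ : ℕ => ρ) (Measure.infinitePi fun _ => ρ) :=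
        ⟨(hev i).measurable.aemeasurable, (hev 0).measurable.aemeasurable, by
          rw [(hev i).map_eq, (hev 0).map_eq]⟩
      exact hid.comp (u := fun x => ‖x‖ ^ 2) (by fun_prop))
  have h3 : ∫ ω : ℕ → EuclideanSpace ℝ (Fin d), ‖ω 0‖ ^ 2 ∂(Measure.infinitePi fun _ : ℕ => ρ) =
      Gamma ((d + 2) / p) / Gamma (d / p) := by
    have h4 := integral_map (μ := Measure.infinitePi fun _ : ℕ => ρ)
      (f := fun x : EuclideanSpace ℝ (Fin d) => ‖x‖ ^ 2)
      (hev 0).measurable.aemeasurable (by fun_prop)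
    rw [(hev 0).map_eq] at h4
    exact h4.symm.trans h2
  rw [h3] at h
  exact h

lemma exists_integral_div_sum_norm_sq_le {d : ℕ} (hd : 1 ≤ d) {p : ℝ} (hp : 0 < p) :
    ∃ C : ℝ, ∀ᶠ N : ℕ in atTop,
      Integrable (fun ω => (N : ℝ) / ∑ i ∈ Finset.range N, ‖ω i‖ ^ 2) (Measure.infinitePi fun _ : ℕ =>
        expPowMeasure d p (∫ x : EuclideanSpace ℝ (Fin d), exp (-‖x‖ ^ p))) ∧
      ∫ ω, (N : ℝ) / ∑ i ∈ Finset.range N, ‖ω i‖ ^ 2 ∂(Measure.infinitePi fun _ : ℕ =>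
        expPowMeasure d p (∫ x : EuclideanSpace ℝ (Fin d), exp (-‖x‖ ^ p))) ≤ C := by
  have := isProbabilityMeasure_expPowMeasure hd hp
  have hd' : (1 : ℝ) ≤ d := by exact_mod_cast hd
  have : Nonempty (Fin d) := ⟨⟨0, hd⟩⟩
  have hs := (integrable_norm_rpow_expPowMeasure hd hp (s := -2 / (3 : ℕ))
    (by push_cast; linarith)).1
  set ρ := expPowMeasure d p (∫ x : EuclideanSpace ℝ (Fin d), exp (-‖x‖ ^ p)) with hρ
  have hρ0 : ρ {0} = 0 :=
    withDensity_absolutelyContinuous _ _ (measure_singleton 0)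
  set I := (∫⁻ x, ENNReal.ofReal (‖x‖ ^ (-(2 : ℝ) / (3 : ℕ))) ∂ρ) ^ 3 with hI
  have hIfin : I ≠ ⊤ := by
    refine ENNReal.pow_ne_top ?_
    rw [← ofReal_integral_eq_lintegral_ofReal hs (.of_forall fun x => by positivity)]
    exact ENNReal.ofReal_ne_top
  refine ⟨I.toReal, ?_⟩
  filter_upwards [eventually_ge_atTop 3] with N hN
  have hle := lintegral_div_sum_sq_le ρ hρ0 (n₀ := 3) (by norm_num) hN
  have hm : Measurable fun ω : ℕ → EuclideanSpace ℝ (Fin d) =>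
      (N : ℝ) / ∑ i ∈ Finset.range N, ‖ω i‖ ^ 2 := by fun_prop
  have h0 : ∀ ω : ℕ → EuclideanSpace ℝ (Fin d),
      0 ≤ (N : ℝ) / ∑ i ∈ Finset.range N, ‖ω i‖ ^ 2 := fun ω => by positivity
  refine ⟨⟨hm.aestronglyMeasurable, ?_⟩, ?_⟩
  · rw [hasFiniteIntegral_iff_ofReal (.of_forall h0)]
    exact hle.trans_lt hIfin.lt_top
  · rw [integral_eq_lintegral_of_nonneg_ae (.of_forall h0) hm.aestronglyMeasurable]
    exact ENNReal.toReal_mono hIfin hle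

lemma tendsto_integral_smul_div_integral {d : ℕ} (hd : 1 ≤ d) {p : ℝ} (hp : 0 < p) {k : ℕ}
    {φ : (Fin k → EuclideanSpace ℝ (Fin d)) → ℝ} (hφ : Continuous φ) {b : ℝ}
    (hφb : ∀ x, |φ x| ≤ b) {s : ℝ} (hs : s = Gamma ((d + 2) / p) / Gamma (d / p)) :
    Tendsto (fun N : ℕ =>
      ∫ ω, φ ((√N / √(∑ i ∈ Finset.range N, ‖ω i‖ ^ 2)) • fun i : Fin k => ω i) *
        (√N / √(∑ i ∈ Finset.range N, ‖ω i‖ ^ 2)) ∂(Measure.infinitePi fun _ : ℕ =>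
          expPowMeasure d p (∫ x : EuclideanSpace ℝ (Fin d), exp (-‖x‖ ^ p)))) atTop
      (nhds ((∫ ω, φ ((√s)⁻¹ • fun i : Fin k => ω i) ∂(Measure.infinitePi fun _ : ℕ =>
        expPowMeasure d p (∫ x : EuclideanSpace ℝ (Fin d), exp (-‖x‖ ^ p)))) * (√s)⁻¹)) := by
  have := isProbabilityMeasure_expPowMeasure hd hp
  have hSL := ae_tendsto_sum_norm_sq_div hd hp
  obtain ⟨C, hC⟩ := exists_integral_div_sum_norm_sq_le hd hp
  have hd' : (0 : ℝ) < d := by exact_mod_cast hd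
  have hs0 : 0 < s := by
    rw [hs]
    exact div_pos (Gamma_pos_of_pos (by positivity)) (Gamma_pos_of_pos (by positivity))
  have hb : 0 ≤ b := (abs_nonneg _).trans (hφb 0)
  rw [← hs] at hSL
  rw [← integral_mul_const]
  have hφm := hφ.measurable
  refine tendsto_integral_of_ae_tendsto_of_integral_sq_le (C := b ^ 2 * C) (b := b * (√s)⁻¹)
    (fun n => by fun_prop) (fun ω => ?_) ?_ ?_
  · rw [abs_mul, abs_of_nonneg (show 0 ≤ (√s)⁻¹ by positivity)]
    gcongr
    exact hφb _
  · filter_upwards [hSL] with ω hω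
    have h1 : Tendsto (fun N : ℕ => √N / √(∑ i ∈ Finset.range N, ‖ω i‖ ^ 2)) atTop
        (nhds (√s)⁻¹) := by
      have := ((continuous_sqrt.tendsto s).comp hω).inv₀ (sqrt_pos.2 hs0).ne'
      refine this.congr fun N => ?_
      simp [Real.sqrt_div (Finset.sum_nonneg fun i _ => sq_nonneg ‖ω i‖)]
    exact ((hφ.tendsto _).comp (h1.smul_const _)).mul h1
  · filter_upwards [hC] with N ⟨hI, hle⟩
    have hptw : ∀ ω : ℕ → EuclideanSpace ℝ (Fin d),
        (φ ((√N / √(∑ i ∈ Finset.range N, ‖ω i‖ ^ 2)) • fun i : Fin k => ω i) *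
        (√N / √(∑ i ∈ Finset.range N, ‖ω i‖ ^ 2))) ^ 2 ≤
        b ^ 2 * (N / ∑ i ∈ Finset.range N, ‖ω i‖ ^ 2) := fun ω => by
      rw [mul_pow, div_pow, Real.sq_sqrt (by positivity), Real.sq_sqrt (by positivity)]
      gcongr ?_ * _
      exact sq_le_sq' (abs_le.1 (hφb _)).1 (abs_le.1 (hφb _)).2
    have hint : Integrable (fun ω : ℕ → EuclideanSpace ℝ (Fin d) =>
        (φ ((√N / √(∑ i ∈ Finset.range N, ‖ω i‖ ^ 2)) • fun i : Fin k => ω i) *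
        (√N / √(∑ i ∈ Finset.range N, ‖ω i‖ ^ 2))) ^ 2) (Measure.infinitePi fun _ : ℕ =>
          expPowMeasure d p (∫ x : EuclideanSpace ℝ (Fin d), exp (-‖x‖ ^ p))) := by
      refine (hI.const_mul (b ^ 2)).mono' (Measurable.aestronglyMeasurable (by fun_prop))
        (.of_forall fun ω => ?_)
      rw [Real.norm_of_nonneg (sq_nonneg _)]
      exact hptw ω
    refine ⟨hint, (integral_mono hint (hI.const_mul _) hptw).trans ?_⟩
    rw [integral_const_mul]
    gcongr

lemma integral_infinitePi_expPowMeasure_smul {d : ℕ} {p c : ℝ} (hc : 0 < c)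
    (hi : Integrable fun x : EuclideanSpace ℝ (Fin d) => exp (-‖x‖ ^ p))
    [IsProbabilityMeasure (expPowMeasure d p c)] {k : ℕ}
    {φ : (Fin k → EuclideanSpace ℝ (Fin d)) → ℝ} (hφ : Measurable φ) {s : ℝ} (hs : 0 < s) :
    ∫ ω, φ ((√s)⁻¹ • fun i : Fin k => ω i) ∂(Measure.infinitePi fun _ : ℕ =>
        expPowMeasure d p c) =
      ∫ x : Fin k → EuclideanSpace ℝ (Fin d), φ x *
        ∏ i, (s ^ ((d : ℝ) / 2) / c * exp (-(√s * ‖x i‖) ^ p)) := by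
  have hm : Measurable fun x : Fin k → EuclideanSpace ℝ (Fin d) =>
    ENNReal.ofReal (∏ i, c⁻¹ * exp (-‖x i‖ ^ p)) := by fun_prop
  have hs' := sqrt_pos.2 hs
  have hmap := map_infinitePi_expPowMeasure (ι := Fin k) (e := fun i => (i : ℕ)) hc hi
    Fin.val_injective
  have h1 := integral_map (μ := Measure.infinitePi fun _ : ℕ => expPowMeasure d p c)
    (φ := fun ω (i : Fin k) => ω i)
    (f := fun x : Fin k → EuclideanSpace ℝ (Fin d) => φ ((√s)⁻¹ • x))
    (Measurable.aemeasurable (by fun_prop)) (Measurable.aestronglyMeasurable (by fun_prop))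
  rw [← h1, hmap, integral_withDensity_eq_integral_toReal_smul hm (by simp)]
  set F : (Fin k → EuclideanSpace ℝ (Fin d)) → ℝ := fun x =>
    (∏ i, c⁻¹ * exp (-‖x i‖ ^ p)) * φ ((√s)⁻¹ • x) with hF
  have h2 := Measure.integral_comp_smul (volume : Measure (Fin k → EuclideanSpace ℝ (Fin d))) F (√s)
  have hfin : Module.finrank ℝ (Fin k → EuclideanSpace ℝ (Fin d)) = d * k := by
    rw [Module.finrank_pi_fintype]
    simp [mul_comm]
  have hpow : √s ^ (d * k) = ∏ _i : Fin k, s ^ ((d : ℝ) / 2) := by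
    rw [Finset.prod_const, Finset.card_univ, Fintype.card_fin, pow_mul, Real.sqrt_eq_rpow,
      ← Real.rpow_mul_natCast hs.le]
    congr 2
    ring
  have h3 : ∫ x, F x = √s ^ (d * k) * ∫ x, F (√s • x) := by
    rw [h2, hfin, smul_eq_mul, abs_of_pos (by positivity), mul_inv_cancel_left₀ (by positivity)]
  calc _ = ∫ x, F x := by
        refine integral_congr_ae (.of_forall fun x => ?_)
        simp only [hF, smul_eq_mul]
        rw [ENNReal.toReal_ofReal (by positivity)]
    _ = _ := by
        rw [h3, ← integral_const_mul]
        refine integral_congr_ae (.of_forall fun x => ?_)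
        simp only [hF, hpow, ← mul_assoc, ← Finset.prod_mul_distrib, inv_smul_smul₀ hs'.ne',
          Pi.smul_apply, norm_smul, Real.norm_of_nonneg hs'.le]
        rw [mul_comm]
        simp only [div_eq_mul_inv]

/-- Chaoticity of the steady state marginals: the `k`-particle marginals of
`F_N(V) = (1/Z̃_N)(Σ |v_i|^{2+α})^{-(dN-1)/(2+α)}` on the sphere `S^{dN-1}(√N)`
converge weakly to the `k`-fold product of
`f(v) = (μ^{d/2}/c) e^{-(√μ |v|)^{2+α}}`.  Sphere integrals are expressed via
the uniform surface measure on the unit sphere, scaled by the radius. -/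
theorem steady_state_chaoticity (d k : ℕ) (hd : 1 ≤ d) (hk : 1 ≤ k)
    (α : ℝ) (hα : 0 < α)
    (c μ : ℝ)
    (hc : c = ∫ v : EuclideanSpace ℝ (Fin d), Real.exp (-‖v‖ ^ (2 + α)))
    (hμ : μ = Real.Gamma (((d : ℝ) + 2) / (2 + α)) / Real.Gamma ((d : ℝ) / (2 + α)))
    (f : EuclideanSpace ℝ (Fin d) → ℝ)
    (hf : ∀ v, f v = μ ^ ((d : ℝ) / 2) / c * Real.exp (-(Real.sqrt μ * ‖v‖) ^ (2 + α)))
    (Ztil : ℕ → ℝ)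
    (hZtil : ∀ N : ℕ, 1 ≤ N → Ztil N = (Real.sqrt N) ^ (d * N - 1) *
      ∫ ω : Metric.sphere (0 : EuclideanSpace ℝ (Fin N × Fin d)) 1,
        (∑ i : Fin N,
          (Real.sqrt N *
            Real.sqrt (∑ j, ((ω : EuclideanSpace ℝ (Fin N × Fin d)) (i, j)) ^ 2)) ^
            (2 + α)) ^ (-((d * N : ℝ) - 1) / (2 + α)) ∂volume.toSphere)
    (fk : (N : ℕ) → (Fin k → EuclideanSpace ℝ (Fin d)) → ℝ)
    (hfk : ∀ N : ℕ, k < N → ∀ Vk : Fin k → EuclideanSpace ℝ (Fin d),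
      (∑ i, ‖Vk i‖ ^ 2) < N →
      fk N Vk = Real.sqrt ((N : ℝ) / ((N : ℝ) - ∑ i, ‖Vk i‖ ^ 2)) *
        ((Real.sqrt ((N : ℝ) - ∑ i, ‖Vk i‖ ^ 2)) ^ (d * (N - k) - 1) *
          ∫ ω : Metric.sphere (0 : EuclideanSpace ℝ (Fin (N - k) × Fin d)) 1,
            (1 / Ztil N) *
              ((∑ i, ‖Vk i‖ ^ (2 + α)) +
                ∑ l : Fin (N - k),
                  (Real.sqrt ((N : ℝ) - ∑ i, ‖Vk i‖ ^ 2) *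
                    Real.sqrt (∑ j,
                      ((ω : EuclideanSpace ℝ (Fin (N - k) × Fin d)) (l, j)) ^ 2)) ^
                    (2 + α)) ^ (-((d * N : ℝ) - 1) / (2 + α)) ∂volume.toSphere))
    (φ : (Fin k → EuclideanSpace ℝ (Fin d)) → ℝ) (hφc : Continuous φ)
    (K : ℝ) (hφK : ∀ x, |φ x| ≤ K) :
    Tendsto (fun N : ℕ =>
        ∫ Vk in {Vk : Fin k → EuclideanSpace ℝ (Fin d) | ∑ i, ‖Vk i‖ ^ 2 < N},
          φ Vk * fk N Vk)
      atTop
      (nhds (∫ Vk : Fin k → EuclideanSpace ℝ (Fin d), φ Vk * ∏ i, f (Vk i))) := by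
  have hp : 0 < 2 + α := by linarith
  set p := 2 + α with hpdef
  have hi := integrable_exp_neg_norm_rpow hd hp
  have hc0 : 0 < c := hc ▸ integral_exp_neg_norm_rpow_pos hd hp
  have hprob : IsProbabilityMeasure (expPowMeasure d p c) :=
    hc ▸ isProbabilityMeasure_expPowMeasure hd hp
  have hd0 : (1 : ℝ) ≤ d := by exact_mod_cast hd
  have hμ0 : 0 < μ := by
    rw [hμ]
    exact div_pos (Gamma_pos_of_pos (by positivity)) (Gamma_pos_of_pos (by positivity))
  have hs := (sqrt_pos.2 hμ0).ne'
  have h1 := tendsto_integral_smul_div_integral hd hp hφc hφK hμ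
  have h2 := tendsto_integral_smul_div_integral (k := k) (φ := fun _ => 1) hd hp continuous_const
    (b := 1) (by simp) hμ
  rw [← hc] at h1 h2
  have h3 := h1.div h2 (by simpa using hs)
  rw [integral_infinitePi_expPowMeasure_smul hc0 hi hφc.measurable hμ0] at h3
  simp only [integral_const, probReal_univ, smul_eq_mul, one_mul] at h3
  rw [mul_div_cancel_right₀ _ (inv_ne_zero hs)] at h3
  simp_rw [hf]
  refine h3.congr' ?_
  filter_upwards [eventually_gt_atTop k] with N hN
  have hN1 : 1 ≤ N := by omega
  have hN2 : (1 : ℝ) < N := by exact_mod_cast (by omega : 1 < N)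
  have hn1 : 1 < (d * N : ℝ) := by nlinarith
  have hNk : k + (N - k) = N := by omega
  have hG := Gamma_pos_of_pos (show 0 < ((d * N : ℝ) - 1) / p from div_pos (by linarith) hp)
  have hZ := integral_sphere_mul hd hN1 hp hc0 hi hn1
  rw [← hZtil N hN1] at hZ
  have hM := integral_mul_sphereMarginal (k := k) (m := N - k) (N := N) hd (by omega) hp hc0 hi
    (by rw [← Nat.cast_add, hNk]) rfl hn1 hφc.measurable
  rw [hNk] at hM
  have hset : MeasurableSet {u : Fin k → EuclideanSpace ℝ (Fin d) | ∑ i, ‖u i‖ ^ 2 < (N : ℝ)} :=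
    measurableSet_lt (by fun_prop) measurable_const
  have hfkS : ∫ u in {u : Fin k → EuclideanSpace ℝ (Fin d) | ∑ i, ‖u i‖ ^ 2 < (N : ℝ)},
      φ u * fk N u = (1 / Ztil N) *
        ∫ u in {u : Fin k → EuclideanSpace ℝ (Fin d) | ∑ i, ‖u i‖ ^ 2 < (N : ℝ)},
          φ u * sphereMarginal d k (N - k) p N (d * N) u := by
    rw [← integral_const_mul]
    refine setIntegral_congr_fun hset fun u hu => ?_
    simp only [hfk N hN u hu, integral_const_mul, sphereMarginal]
    ring
  rw [hfkS]
  simp only [Pi.div_apply, div_eq_mul_inv √(N : ℝ), mul_left_comm _ √(N : ℝ),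
    integral_const_mul]
  simp only [← div_eq_mul_inv] at hM ⊢
  rw [← hM, ← hZ, mul_div_mul_left _ _ (by positivity), mul_div_mul_right _ _ (by positivity)]
  ring
end

section
/- (LLN with logarithmic weight) Let g(w) = e^{−|w|^{2+α}}/c be the normalized density on ℝ^d with μ = ∫ |w|² g(w) dw. Then lim_{N→∞} ∫_{ℝ^{dN}} log(|W|/√N) · (√N/|W|) ∏_{i=1}^N g(w_i) dW = (log √μ)/√μ. -/
open Real MeasureTheory Filter

theorem abs_log_div_self_le {x : ℝ} (hx : 0 < x) : |log x / x| ≤ 1 + (x ^ 2)⁻¹ := by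
  have h1 : log x ≤ x := (log_le_sub_one_of_pos hx).trans (by linarith)
  have h2 : -log x ≤ x⁻¹ := by
    rw [← log_inv]
    exact (log_le_sub_one_of_pos (inv_pos.2 hx)).trans (by linarith)
  have hi : 0 < x⁻¹ := inv_pos.2 hx
  have h3 : |log x| ≤ x + x⁻¹ := abs_le.2 ⟨by linarith, by linarith⟩
  rw [abs_div, abs_of_pos hx, div_le_iff₀ hx]
  refine h3.trans (le_of_eq ?_)
  field_simp

theorem abs_log_sqrt_div_sqrt_le {t : ℝ} (ht : 0 < t) :
    |log √t / √t| ≤ 1 + t⁻¹ := by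
  simpa [sq_sqrt ht.le] using abs_log_div_self_le (sqrt_pos.2 ht)

theorem abs_log_sqrt_div_sqrt_sub_max_le {t δ : ℝ} (ht : 0 < t) (hδ : 0 < δ) (hδ1 : δ ≤ 1) :
    |log √t / √t - log √(max t δ) / √(max t δ)| ≤ 4 * δ * (t⁻¹) ^ 2 := by
  rcases le_total δ t with h | h
  · rw [max_eq_left h, sub_self, abs_zero]; positivity
  · rw [max_eq_right h]
    have h1 := abs_log_sqrt_div_sqrt_le ht
    have h2 := abs_log_sqrt_div_sqrt_le hδ
    have h3 : δ⁻¹ ≤ t⁻¹ := inv_anti₀ ht h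
    have h4 : 1 ≤ δ⁻¹ := (one_le_inv₀ hδ).2 hδ1
    have h5 : t⁻¹ ≤ δ * (t⁻¹) ^ 2 := by
      have : 1 ≤ δ * t⁻¹ := by rw [← div_eq_mul_inv, one_le_div ht]; exact h
      nlinarith [inv_pos.2 ht]
    have h6 := norm_sub_le (log √t / √t) (log √δ / √δ)
    simp only [norm_eq_abs] at h6
    linarith

theorem inv_mean_sq_le_prod_rpow {N : ℕ} (hN : 0 < N) {x : Fin N → ℝ} (hx : ∀ i, 0 < x i) :
    (((∑ i, x i) / N)⁻¹) ^ 2 ≤ ∏ i, x i ^ (-2 / N : ℝ) := by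
  have hN' : (0 : ℝ) < N := by exact_mod_cast hN
  have h := geom_mean_le_arith_mean_weighted Finset.univ (fun _ : Fin N => (N : ℝ)⁻¹) x
    (fun _ _ => by positivity) (by simp [hN'.ne']) (fun i _ => (hx i).le)
  rw [← Finset.mul_sum, mul_comm, ← div_eq_mul_inv] at h
  have hp : 0 < ∏ i, x i ^ (N : ℝ)⁻¹ := Finset.prod_pos fun i _ => rpow_pos_of_pos (hx i) _
  calc _ ≤ ((∏ i, x i ^ (N : ℝ)⁻¹)⁻¹) ^ 2 := by
        have := inv_anti₀ hp h
        have h0 : 0 ≤ ((∑ i, x i) / N)⁻¹ := inv_nonneg.2 (hp.le.trans h)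
        gcongr
    _ = _ := by
        rw [← Finset.prod_inv_distrib, ← Finset.prod_pow]
        refine Finset.prod_congr rfl fun i _ => ?_
        rw [← rpow_neg (hx i).le, ← rpow_natCast, ← rpow_mul (hx i).le]
        congr 1
        push_cast
        ring

theorem continuousOn_log_sqrt_div_sqrt :
    ContinuousOn (fun t : ℝ => log √t / √t) (Set.Ioi 0) := by
  intro t ht
  have : √t ≠ 0 := (sqrt_pos.2 ht).ne'
  exact (ContinuousAt.div ((continuous_sqrt.continuousAt).log this) continuous_sqrt.continuousAt
    this).continuousWithinAt

theorem tendsto_mean_ae {E : Type*} [MeasurableSpace E] (ν : Measure E) [IsProbabilityMeasure ν]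
    {f : E → ℝ} (hf : Measurable f) (hfi : Integrable f ν) :
    ∀ᵐ ω ∂(Measure.infinitePi fun _ : ℕ => ν),
      Tendsto (fun N : ℕ => (∑ i : Fin N, f (ω i)) / N) atTop (nhds (∫ x, f x ∂ν)) := by
  have hev (i : ℕ) : MeasurePreserving (fun ω : ℕ → E => ω i)
      (Measure.infinitePi fun _ : ℕ => ν) ν := measurePreserving_eval_infinitePi _ i
  have hind := ProbabilityTheory.iIndepFun_infinitePi (P := fun _ : ℕ => ν)
    (X := fun _ : ℕ => f) (fun _ => hf)
  have := ProbabilityTheory.strong_law_ae_real (μ := Measure.infinitePi fun _ : ℕ => ν)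
    (fun i ω => f (ω i)) ((hev 0).integrable_comp_of_integrable hfi)
    (fun i j hij => hind.indepFun hij)
    (fun i => ⟨(hf.comp (hev i).measurable).aemeasurable,
      (hf.comp (hev 0).measurable).aemeasurable, by
      have h (i : ℕ) : Measure.map (fun ω : ℕ → E => f (ω i)) (Measure.infinitePi fun _ => ν)
          = ν.map f := by
        rw [← (hev i).map_eq, Measure.map_map hf (hev i).measurable, (hev i).map_eq]
        rfl
      rw [h, h]⟩)
  have he : ∫ ω, f (ω 0) ∂(Measure.infinitePi fun _ : ℕ => ν) = ∫ x, f x ∂ν := by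
    rw [← (hev 0).map_eq, integral_map (hev 0).measurable.aemeasurable hf.aestronglyMeasurable,
      (hev 0).map_eq]
  rw [he] at this
  filter_upwards [this] with ω hω
  simpa [Finset.sum_range] using hω

theorem integral_pi_eq_integral_infinitePi {E : Type*} [MeasurableSpace E] (ν : Measure E)
    [IsProbabilityMeasure ν] {N : ℕ} {F : (Fin N → E) → ℝ} (hF : Measurable F) :
    ∫ W, F W ∂(Measure.pi fun _ => ν) =
      ∫ ω, F (fun i => ω i) ∂(Measure.infinitePi fun _ : ℕ => ν) := by
  have := Measure.map_infinitePi_infinitePi_of_inj (P := fun _ : ℕ => ν) 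
    (f := ((↑) : Fin N → ℕ)) Fin.val_injective
  rw [← Measure.infinitePi_eq_pi, ← this, integral_map (Measurable.aemeasurable (by fun_prop))
    hF.aestronglyMeasurable]

theorem integral_rpow_pow_le {E : Type*} [MeasurableSpace E] (ν : Measure E)
    [IsProbabilityMeasure ν] {f : E → ℝ} (hf : Measurable f) (hf0 : ∀ x, 0 ≤ f x)
    (hfi : Integrable (fun x => f x ^ (-1 / 4 : ℝ)) ν) {N : ℕ} (hN : 8 ≤ N) :
    Integrable (fun x => f x ^ (-2 / N : ℝ)) ν ∧
      (∫ x, f x ^ (-2 / N : ℝ) ∂ν) ^ N ≤ exp (8 * ∫ x, f x ^ (-1 / 4 : ℝ) ∂ν) := by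
  have hN' : (8 : ℝ) ≤ N := by exact_mod_cast hN
  have hN0 : (0 : ℝ) < N := by linarith
  have hb (x : E) : f x ^ (-2 / N : ℝ) ≤ 1 + 8 / N * f x ^ (-1 / 4 : ℝ) := by
    have h0 : 0 ≤ f x ^ (-1 / 4 : ℝ) := rpow_nonneg (hf0 x) _
    have := rpow_one_add_le_one_add_mul_self (s := f x ^ (-1 / 4 : ℝ) - 1) (by linarith)
      (p := 8 / N) (by positivity) (by rw [div_le_one hN0]; exact hN')
    rw [add_sub_cancel, ← rpow_mul (hf0 x)] at this
    have e : (-1 / 4 * (8 / N) : ℝ) = -2 / N := by ring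
    rw [e] at this
    have : 0 < 8 / (N : ℝ) := by positivity
    linarith
  have hi2 := (integrable_const (μ := ν) (1 : ℝ)).add (hfi.const_mul (8 / N : ℝ))
  have hi : Integrable (fun x => f x ^ (-2 / N : ℝ)) ν := by
    refine hi2.mono' (hf.pow_const _).aestronglyMeasurable (.of_forall fun x => ?_)
    rw [norm_of_nonneg (rpow_nonneg (hf0 x) _)]
    exact hb x
  refine ⟨hi, ?_⟩
  have h1 := integral_mono hi hi2 hb
  simp only [Pi.add_apply] at h1
  rw [integral_add (integrable_const _) (hfi.const_mul _), integral_const_mul] at h1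
  simp only [integral_const, probReal_univ, smul_eq_mul, mul_one] at h1
  set I := ∫ x, f x ^ (-1 / 4 : ℝ) ∂ν
  calc _ ≤ (exp (8 / N * I)) ^ N := by
        refine pow_le_pow_left₀ (integral_nonneg fun x => rpow_nonneg (hf0 x) _) ?_ N
        linarith [add_one_le_exp (8 / N * I)]
    _ = _ := by
        rw [← exp_nat_mul]
        congr 1
        field_simp

theorem tendsto_integral_log_sqrt_mean {E : Type*} [MeasurableSpace E] (ν : Measure E)
    [IsProbabilityMeasure ν] {f : E → ℝ} (hf : Measurable f) (hf0 : ∀ x, 0 ≤ f x)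
    (hpos : ∀ᵐ x ∂ν, 0 < f x) (hfi : Integrable f ν)
    (hfi' : Integrable (fun x => f x ^ (-1 / 4 : ℝ)) ν) (hm : 0 < ∫ x, f x ∂ν) :
    Tendsto (fun N : ℕ => ∫ W : Fin N → E, log √((∑ i, f (W i)) / N) / √((∑ i, f (W i)) / N)
        ∂(Measure.pi fun _ => ν)) atTop
      (nhds (log √(∫ x, f x ∂ν) / √(∫ x, f x ∂ν))) := by
  set m := ∫ x, f x ∂ν
  set K := exp (8 * ∫ x, f x ^ (-1 / 4 : ℝ) ∂ν)
  have hKpos : 0 < K := exp_pos _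
  have hmeas (N : ℕ) : Measurable fun W : Fin N → E => (∑ i, f (W i)) / N := by fun_prop
  have hlog : Measurable fun t : ℝ => log √t / √t := by fun_prop
  rw [Metric.tendsto_atTop]
  intro ε hε
  set δ := min (min 1 m) (ε / (16 * K))
  have hδ : 0 < δ := by positivity
  have hδ1 : δ ≤ 1 := (min_le_left _ _).trans (min_le_left _ _)
  have hδm : δ ≤ m := (min_le_left _ _).trans (min_le_right _ _)
  have hδε : 4 * δ * K ≤ ε / 4 := by
    have : δ ≤ ε / (16 * K) := min_le_right _ _
    rw [le_div_iff₀ (by positivity)] at this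
    linarith
  set ψ : ℝ → ℝ := fun t => log √(max t δ) / √(max t δ) with hψ
  have hψc : Continuous ψ :=
    continuousOn_log_sqrt_div_sqrt.comp_continuous (f := fun t => max t δ) (by fun_prop)
      fun t => hδ.trans_le (le_max_right _ _)
  have hψb (t : ℝ) : ‖ψ t‖ ≤ 1 + δ⁻¹ := by
    refine (abs_log_sqrt_div_sqrt_le (hδ.trans_le (le_max_right t δ))).trans ?_
    gcongr
    exact le_max_right _ _
  have hlim : Tendsto (fun N : ℕ => ∫ W : Fin N → E, ψ ((∑ i, f (W i)) / N)
      ∂(Measure.pi fun _ => ν)) atTop (nhds (log √m / √m)) := by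
    have he (N : ℕ) := integral_pi_eq_integral_infinitePi ν (hψc.measurable.comp (hmeas N))
    simp only [Function.comp_apply] at he
    simp only [he]
    have hc : log √m / √m = ∫ _, ψ m ∂(Measure.infinitePi fun _ : ℕ => ν) := by
      simp [hψ, max_eq_left hδm]
    rw [hc]
    refine tendsto_integral_of_dominated_convergence (fun _ => 1 + δ⁻¹)
      (fun N => (hψc.measurable.comp (by fun_prop)).aestronglyMeasurable) (integrable_const _)
      (fun N => .of_forall fun ω => hψb _) ?_
    filter_upwards [tendsto_mean_ae ν hf hfi] with ω hω
    exact (hψc.tendsto m).comp hω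
  obtain ⟨N₀, hN₀⟩ := Metric.tendsto_atTop.1 hlim (ε / 2) (by positivity)
  refine ⟨max N₀ 8, fun N hN => ?_⟩
  have hN8 : 8 ≤ N := (le_max_right _ _).trans hN
  have h2 := hN₀ N ((le_max_left _ _).trans hN)
  obtain ⟨hi, hle⟩ := integral_rpow_pow_le ν hf hf0 hfi' hN8
  have hprod : Integrable (fun W : Fin N → E => ∏ i, f (W i) ^ (-2 / N : ℝ))
      (Measure.pi fun _ => ν) := Integrable.fintype_prod (fun _ => hi)
  have hprodle : ∫ W : Fin N → E, ∏ i, f (W i) ^ (-2 / N : ℝ) ∂(Measure.pi fun _ => ν) ≤ K := by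
    rw [integral_fintype_prod_eq_pow (fun x => f x ^ (-2 / N : ℝ)), Fintype.card_fin]
    exact hle
  have hae : ∀ᵐ W : Fin N → E ∂(Measure.pi fun _ => ν), ∀ i, 0 < f (W i) :=
    ae_all_iff.2 fun i =>
      (measurePreserving_eval (fun _ : Fin N => ν) i).quasiMeasurePreserving.ae hpos
  have hdiff : ∀ᵐ W : Fin N → E ∂(Measure.pi fun _ => ν),
      ‖log √((∑ i, f (W i)) / N) / √((∑ i, f (W i)) / N) - ψ ((∑ i, f (W i)) / N)‖
        ≤ 4 * δ * ∏ i, f (W i) ^ (-2 / N : ℝ) := by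
    filter_upwards [hae] with W hW
    have : NeZero N := ⟨by omega⟩
    have hS : 0 < (∑ i, f (W i)) / N :=
      div_pos (Finset.sum_pos (fun i _ => hW i) Finset.univ_nonempty) (by positivity)
    refine (abs_log_sqrt_div_sqrt_sub_max_le hS hδ hδ1).trans ?_
    gcongr
    exact inv_mean_sq_le_prod_rpow (by omega) hW
  have hdm : AEStronglyMeasurable (fun W : Fin N → E => log √((∑ i, f (W i)) / N) /
      √((∑ i, f (W i)) / N) - ψ ((∑ i, f (W i)) / N)) (Measure.pi fun _ => ν) :=
    ((hlog.comp (hmeas N)).sub (hψc.measurable.comp (hmeas N))).aestronglyMeasurable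
  have hdi := (hprod.const_mul (4 * δ)).mono' hdm hdiff
  have hψi : Integrable (fun W : Fin N → E => ψ ((∑ i, f (W i)) / N)) (Measure.pi fun _ => ν) :=
    (integrable_const (1 + δ⁻¹)).mono' (hψc.measurable.comp (hmeas N)).aestronglyMeasurable
      (.of_forall fun W => hψb _)
  have hb := norm_integral_le_of_norm_le (hprod.const_mul (4 * δ)) hdiff
  have hsplit := integral_add hdi hψi
  simp only [sub_add_cancel] at hsplit
  rw [integral_const_mul] at hb
  have hb' := hb.trans (mul_le_mul_of_nonneg_left hprodle (by positivity))
  rw [hsplit, dist_eq_norm, add_sub_assoc]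
  rw [dist_eq_norm] at h2
  refine (norm_add_le _ _).trans_lt ?_
  linarith

theorem pi_withDensity_ofReal_s19 {E : Type*} [MeasurableSpace E] (ρ : Measure E) [SigmaFinite ρ]
    {g : E → ℝ} (hg0 : ∀ x, 0 ≤ g x) (hgi : Integrable g ρ) (N : ℕ)
    [SigmaFinite (ρ.withDensity fun x => ENNReal.ofReal (g x))] :
    (Measure.pi fun _ : Fin N => ρ.withDensity fun x => ENNReal.ofReal (g x)) =
      (Measure.pi fun _ : Fin N => ρ).withDensity fun W => ENNReal.ofReal (∏ i, g (W i)) := by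
  refine Measure.pi_eq fun s hs => ?_
  have h1 : Integrable (fun W : Fin N → E => ∏ i, g (W i)) (Measure.pi fun _ => ρ) :=
    Integrable.fintype_prod fun _ => hgi
  have hsm := MeasurableSet.univ_pi hs
  rw [withDensity_apply _ hsm, ← ofReal_integral_eq_lintegral_ofReal h1.integrableOn
    (.of_forall fun W => Finset.prod_nonneg fun i _ => hg0 _), Measure.restrict_pi_pi,
    integral_fintype_prod_eq_prod fun _ => g,
    ENNReal.ofReal_prod_of_nonneg fun i _ => integral_nonneg hg0]
  refine Finset.prod_congr rfl fun i _ => ?_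
  rw [withDensity_apply _ (hs i), ofReal_integral_eq_lintegral_ofReal hgi.integrableOn
    (.of_forall hg0)]

theorem integrable_norm_rpow_mul_exp_neg_norm_rpow {E : Type*} [NormedAddCommGroup E]
    [NormedSpace ℝ E] [FiniteDimensional ℝ E] [Nontrivial E] [MeasurableSpace E] [BorelSpace E]
    (ρ : Measure E) [ρ.IsAddHaarMeasure] {s p : ℝ} (hs : -1 < s) (hp : 0 < p) :
    Integrable (fun w : E => ‖w‖ ^ s * exp (-‖w‖ ^ p)) ρ := by
  rw [integrable_fun_norm_addHaar ρ (f := fun y => y ^ s * exp (-y ^ p))]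
  refine (integrableOn_rpow_mul_exp_neg_rpow
    (s := s + (Module.finrank ℝ E - 1 : ℕ)) ?_ hp).congr_fun ?_ measurableSet_Ioi
  · linarith [(Nat.cast_nonneg (Module.finrank ℝ E - 1) : (0 : ℝ) ≤ _)]
  · intro y hy
    simp only [smul_eq_mul]
    rw [rpow_add hy, rpow_natCast]
    ring

theorem integral_withDensity_ofReal {E : Type*} [MeasurableSpace E] (ρ : Measure E)
    {g : E → ℝ} (hg : Measurable g) (hg0 : ∀ x, 0 ≤ g x) (F : E → ℝ) :
    ∫ x, F x ∂(ρ.withDensity fun x => ENNReal.ofReal (g x)) = ∫ x, F x * g x ∂ρ := by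
  rw [integral_withDensity_eq_integral_toReal_smul hg.ennreal_ofReal (by simp)]
  simp only [ENNReal.toReal_ofReal (hg0 _), smul_eq_mul, mul_comm]

theorem integrable_withDensity_ofReal_iff {E : Type*} [MeasurableSpace E] (ρ : Measure E)
    {g : E → ℝ} (hg : Measurable g) (hg0 : ∀ x, 0 ≤ g x) (F : E → ℝ) :
    Integrable F (ρ.withDensity fun x => ENNReal.ofReal (g x)) ↔
      Integrable (fun x => F x * g x) ρ := by
  rw [integrable_withDensity_iff_integrable_smul' hg.ennreal_ofReal (by simp)]
  simp only [ENNReal.toReal_ofReal (hg0 _), smul_eq_mul, mul_comm]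

/-- LLN with logarithmic weight:
`lim_{N→∞} ∫ log(|W|/√N) (√N/|W|) ∏ g(w_i) dW = (log √μ)/√μ`
for the normalized density `g(w) = e^{-|w|^{2+α}}/c` with `μ = ∫ |w|² g`. -/
theorem lln_logarithmic_weight (d : ℕ) (hd : 1 ≤ d) (α : ℝ) (hα : 0 < α)
    (c : ℝ) (hc : c = ∫ w : EuclideanSpace ℝ (Fin d), Real.exp (-‖w‖ ^ (2 + α)))
    (g : EuclideanSpace ℝ (Fin d) → ℝ)
    (hg : ∀ w, g w = Real.exp (-‖w‖ ^ (2 + α)) / c)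
    (μ : ℝ) (hμ : μ = ∫ w : EuclideanSpace ℝ (Fin d), ‖w‖ ^ 2 * g w) :
    Tendsto (fun N : ℕ =>
        ∫ W : Fin N → EuclideanSpace ℝ (Fin d),
          Real.log (Real.sqrt (∑ i, ‖W i‖ ^ 2) / Real.sqrt N) *
            (Real.sqrt N / Real.sqrt (∑ i, ‖W i‖ ^ 2)) * ∏ i, g (W i))
      atTop (nhds (Real.log (Real.sqrt μ) / Real.sqrt μ)) := by
  have : Nonempty (Fin d) := ⟨⟨0, hd⟩⟩
  have hp : 0 < 2 + α := by linarith
  have hexp {s : ℝ} (hs : -1 < s) :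
      Integrable fun w : EuclideanSpace ℝ (Fin d) => ‖w‖ ^ s * exp (-‖w‖ ^ (2 + α)) :=
    integrable_norm_rpow_mul_exp_neg_norm_rpow volume hs hp
  have hexp0 : Integrable fun w : EuclideanSpace ℝ (Fin d) => exp (-‖w‖ ^ (2 + α)) := by
    simpa using hexp (s := 0) (by norm_num)
  have hcpos : 0 < c := hc ▸ integral_exp_pos hexp0
  have hgpos (w) : 0 < g w := by rw [hg]; positivity
  have hg0 (w) : 0 ≤ g w := (hgpos w).le
  have hgm : Measurable g := by
    rw [funext hg]
    fun_prop
  have hgs {s : ℝ} (hs : -1 < s) : Integrable fun w => ‖w‖ ^ s * g w := by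
    simp only [hg, ← mul_div_assoc]
    exact (hexp hs).div_const c
  have hgi : Integrable g := by simpa using hgs (s := 0) (by norm_num)
  have hg1 : ∫ w, g w = 1 := by
    simp only [hg]
    rw [integral_div, ← hc, div_self hcpos.ne']
  have hsq : Integrable fun w => ‖w‖ ^ 2 * g w := by
    simpa using hgs (s := 2) (by norm_num)
  have hμpos : 0 < μ := by
    rw [hμ, integral_pos_iff_support_of_nonneg (fun w => mul_nonneg (by positivity) (hg0 w)) hsq]
    have : (Function.support fun w => ‖w‖ ^ 2 * g w) = {0}ᶜ := by
      ext w
      simp [(hgpos w).ne']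
    rw [this]
    exact isOpen_compl_singleton.measure_pos _ (exists_ne 0)
  set ν := (volume : Measure (EuclideanSpace ℝ (Fin d))).withDensity
    fun w => ENNReal.ofReal (g w) with hν
  have hνp : IsProbabilityMeasure ν := ⟨by
    rw [hν, withDensity_apply _ MeasurableSet.univ, Measure.restrict_univ,
      ← ofReal_integral_eq_lintegral_ofReal hgi (.of_forall hg0), hg1, ENNReal.ofReal_one]⟩
  have hμν : ∫ w, ‖w‖ ^ 2 ∂ν = μ := by
    rw [hν, integral_withDensity_ofReal _ hgm hg0, hμ]
  have key := tendsto_integral_log_sqrt_mean ν (f := fun w => ‖w‖ ^ 2) (by fun_prop)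
    (fun w => by positivity)
    ((withDensity_absolutelyContinuous volume _).ae_le <| by
      filter_upwards [Measure.ae_ne volume (0 : EuclideanSpace ℝ (Fin d))] with w hw
      positivity)
    ((integrable_withDensity_ofReal_iff _ hgm hg0 _).2 hsq)
    ((integrable_withDensity_ofReal_iff _ hgm hg0 _).2 <| by
      refine (hgs (s := -1 / 2) (by norm_num)).congr (.of_forall fun w => ?_)
      simp only
      rw [← rpow_natCast, ← rpow_mul (norm_nonneg w)]
      norm_num)
    (hμν ▸ hμpos)
  rw [hμν] at key
  refine key.congr fun N => ?_
  rw [hν, pi_withDensity_ofReal_s19 _ hg0 hgi, integral_withDensity_ofReal _ (by fun_prop)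
    fun W => Finset.prod_nonneg fun i _ => hg0 _]
  refine integral_congr_ae (.of_forall fun W => ?_)
  simp only
  rw [sqrt_div (Finset.sum_nonneg fun i _ => by positivity), div_eq_mul_inv (log _), inv_div]
end
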